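/- arXiv:1404.0151 — 3 statements merged into one kernel-verified Lean document; each statement's English description precedes it below -/
import Mathlib

section
/- Let G be a digraph with vertex b and let I ⊆ V(G) \ {b} be maximal with the property that every finite subset of I admits an edge-disjoint linkage to b. Then for every vertex v ∈ (V(G) \ {b}) \ I there exists an exact vertex set D containing v. -/
/-- A (finite) directed path in the digraph with adjacency `Adj`:
a nonempty list of distinct vertices whose consecutive pairs are edges. -/
structure DiPath {V : Type*} (Adj : V → V → Prop) : Type _ where
  verts : List V
  ne : verts ≠ []
  chain : verts.Chain' Adj
  nodup : verts.Nodup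

namespace DiPath
variable {V : Type*} {Adj : V → V → Prop}
/-- The first vertex of a directed path. -/
def first (P : DiPath Adj) : V := P.verts.head P.ne
/-- The last vertex of a directed path. -/
def last (P : DiPath Adj) : V := P.verts.getLast P.ne
/-- The (directed) edges of a path, as ordered pairs of consecutive vertices. -/
def edges (P : DiPath Adj) : List (V × V) := P.verts.zip P.verts.tail
/-- The edge set of a path. -/
def edgeSet (P : DiPath Adj) : Set (V × V) := {e | e ∈ P.edges}
/-- The vertex set of a path. -/
def vertexSet (P : DiPath Adj) : Set V := {v | v ∈ P.verts}
end DiPath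

/-- A directed ray: a one-way infinite directed path. -/
structure DiRay {V : Type*} (Adj : V → V → Prop) : Type _ where
  f : ℕ → V
  inj : Function.Injective f
  adj : ∀ n, Adj (f n) (f (n + 1))

namespace DiRay
variable {V : Type*} {Adj : V → V → Prop}
/-- The first vertex of a ray. -/
def first (R : DiRay Adj) : V := R.f 0
/-- The edge set of a ray. -/
def edgeSet (R : DiRay Adj) : Set (V × V) := Set.range fun n => (R.f n, R.f (n + 1))
/-- The vertex set of a ray. -/
def vertexSet (R : DiRay Adj) : Set V := Set.range R.f
end DiRay

/-- A path or a ray. -/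
inductive PR {V : Type*} (Adj : V → V → Prop) : Type _
  | path : DiPath Adj → PR Adj
  | ray : DiRay Adj → PR Adj

namespace PR
variable {V : Type*} {Adj : V → V → Prop}
/-- The first vertex. -/
def first : PR Adj → V
  | .path P => P.first
  | .ray R => R.first
/-- The edge set. -/
def edgeSet : PR Adj → Set (V × V)
  | .path P => P.edgeSet
  | .ray R => R.edgeSet
/-- The vertex set. -/
def vertexSet : PR Adj → Set V
  | .path P => P.vertexSet
  | .ray R => R.vertexSet
end PR

/-- A vertex `v` dominates `b` (edge version): there are infinitely many
pairwise edge-disjoint directed `v`–`b` paths. -/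
def VDom {V : Type*} (Adj : V → V → Prop) (b v : V) : Prop :=
  ∃ P : ℕ → DiPath Adj, Function.Injective P ∧ (∀ n, (P n).first = v) ∧
    (∀ n, (P n).last = b) ∧ ∀ m n, m ≠ n → Disjoint (P m).edgeSet (P n).edgeSet

/-- A ray `R` dominates `b` (edge version): there are infinitely many pairwise
edge-disjoint directed paths from `R` to `b`. -/
def RDom {V : Type*} (Adj : V → V → Prop) (b : V) (R : DiRay Adj) : Prop :=
  ∃ P : ℕ → DiPath Adj, Function.Injective P ∧ (∀ n, (P n).first ∈ R.vertexSet) ∧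
    (∀ n, (P n).last = b) ∧ ∀ m n, m ≠ n → Disjoint (P m).edgeSet (P n).edgeSet

/-- A path or ray is good for `b` if it ends at `b` or dominates `b`
(a path dominates `b` if its last vertex does; a ray dominates as a ray). -/
def PR.Good {V : Type*} {Adj : V → V → Prop} (b : V) : PR Adj → Prop
  | .path P => P.last = b ∨ VDom Adj b P.last
  | .ray R => RDom Adj b R

/-- A domination linkage (edge version) from `I` to `b`: pairwise edge-disjoint
paths or rays, one starting at each vertex of `I`, each ending at `b` or dominating `b`. -/
def DomLinkage {V : Type*} (Adj : V → V → Prop) (b : V) (I : Set V) : Prop :=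
  ∃ Q : I → PR Adj, (∀ v : I, (Q v).first = (v : V)) ∧ (∀ v, (Q v).Good b) ∧
    ∀ v w : I, v ≠ w → Disjoint (Q v).edgeSet (Q w).edgeSet

/-- The finite set `S` can be linked to `b` by pairwise edge-disjoint directed paths,
one starting at each vertex of `S`, each ending at `b`. -/
def FinLinked {V : Type*} (Adj : V → V → Prop) (b : V) (S : Finset V) : Prop :=
  ∃ P : S → DiPath Adj, (∀ s, (P s).first = (s : V)) ∧ (∀ s, (P s).last = b) ∧
    ∀ s t, s ≠ t → Disjoint (P s).edgeSet (P t).edgeSet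

/-- The set of `D`-crossing edges: edges with tail in `D` and head outside `D`. -/
def Cross {V : Type*} (Adj : V → V → Prop) (D : Set V) : Set (V × V) :=
  {e | Adj e.1 e.2 ∧ e.1 ∈ D ∧ e.2 ∉ D}

/-- `D` is exact (for `I` and `b`): `b ∉ D` and the number of `D`-crossing
edges is finite and equals `|D ∩ I|`. -/
def Exact {V : Type*} (Adj : V → V → Prop) (b : V) (I D : Set V) : Prop :=
  b ∉ D ∧ (Cross Adj D).Finite ∧ (D ∩ I).Finite ∧
    (Cross Adj D).ncard = (D ∩ I).ncard

section EdgeMenger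

variable {V : Type*}

theorem List.rel_of_mem_zip_tail {r : V → V → Prop} :
    ∀ {l : List V}, l.IsChain r → ∀ e ∈ l.zip l.tail, r e.1 e.2
  | [], _, e, he => by simp at he
  | [x], _, e, he => by simp at he
  | x :: y :: l, h, e, he => by
    rw [List.isChain_cons_cons] at h
    simp only [List.tail_cons, List.zip_cons_cons, List.mem_cons] at he
    rcases he with rfl | he
    · exact h.1
    · exact List.rel_of_mem_zip_tail h.2 e he

theorem List.fst_mem_of_mem_zip_tail {l : List V} {e : V × V} (he : e ∈ l.zip l.tail) :
    e.1 ∈ l :=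
  (List.of_mem_zip (a := e.1) (b := e.2) he).1

theorem List.Nodup.zip_tail : ∀ {l : List V}, l.Nodup → (l.zip l.tail).Nodup
  | [], _ => by simp
  | [x], _ => by simp
  | x :: y :: l, h => by
    rw [List.nodup_cons] at h
    simp only [List.tail_cons, List.zip_cons_cons, List.nodup_cons]
    exact ⟨fun hm => h.1 (List.fst_mem_of_mem_zip_tail (l := y :: l) hm),
      List.Nodup.zip_tail h.2⟩

theorem List.sum_zip_tail_sub (g : V → ℤ) :
    ∀ (l : List V) (hl : l ≠ []),
      ((l.zip l.tail).map fun e => g e.1 - g e.2).sum = g (l.head hl) - g (l.getLast hl)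
  | [], hl => absurd rfl hl
  | [x], _ => by simp
  | x :: y :: l, _ => by
    have h := List.sum_zip_tail_sub g (y :: l) (by simp)
    simp only [List.tail_cons, List.head_cons] at h
    simp only [List.tail_cons, List.zip_cons_cons, List.map_cons, List.sum_cons, List.head_cons,
      List.getLast_cons_cons, h]
    ring

theorem List.exists_mem_zip_tail_crossing (D : Set V) :
    ∀ (l : List V) (hl : l ≠ []), l.head hl ∈ D → l.getLast hl ∉ D →
      ∃ e ∈ l.zip l.tail, e.1 ∈ D ∧ e.2 ∉ D
  | [], hl, _, _ => absurd rfl hl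
  | [x], _, h, h' => absurd h h'
  | x :: y :: l, _, h, h' => by
    by_cases hy : y ∈ D
    · obtain ⟨e, he, hD⟩ :=
        List.exists_mem_zip_tail_crossing D (y :: l) (by simp) hy (by simpa using h')
      exact ⟨e, by simpa using Or.inr he, hD⟩
    · exact ⟨(x, y), by simp, h, hy⟩

/-- A reachable vertex is reachable along a path without repeated vertices. -/
theorem DiPath.exists_of_reflTransGen {r : V → V → Prop} {x b : V}
    (h : Relation.ReflTransGen r x b) : ∃ P : DiPath r, P.first = x ∧ P.last = b := by
  induction h using Relation.ReflTransGen.head_induction_on with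
  | refl => exact ⟨⟨[b], by simp, List.isChain_singleton b, by simp⟩, rfl, rfl⟩
  | @head x y hxy _ ih =>
    obtain ⟨⟨l, ne, hc, hn⟩, hf, hl⟩ := ih
    simp only [DiPath.first, DiPath.last] at hf hl
    by_cases hx : x ∈ l
    · obtain ⟨l₁, l₂, rfl⟩ := List.append_of_mem hx
      refine ⟨⟨x :: l₂, by simp, hc.right_of_append, hn.of_append_right⟩, rfl, ?_⟩
      simpa [DiPath.last] using hl
    · refine ⟨⟨x :: l, by simp, ?_, List.nodup_cons.2 ⟨hx, hn⟩⟩, rfl, ?_⟩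
      · cases l with
        | nil => exact absurd rfl ne
        | cons a l =>
          simp only [List.head_cons] at hf
          subst hf
          exact List.isChain_cons_cons.2 ⟨hxy, hc⟩
      · simpa [DiPath.last, List.getLast_cons ne] using hl

open scoped Classical in
/-- Out-degree minus in-degree of `z` in a finite edge set. -/
noncomputable def netOut (F : Finset (V × V)) (z : V) : ℤ :=
  ∑ e ∈ F, ((if e.1 = z then 1 else 0) - (if e.2 = z then 1 else 0))

open scoped Classical in
theorem sum_crossing_eq_card {b : V} {T : Finset V} {F : Finset (V × V)}
    (hF : ∀ z, z ≠ b → netOut F z = if z ∈ T then 1 else 0) {D : Set V} (hbD : b ∉ D) :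
    ∑ e ∈ F, ((if e.1 ∈ D then (1 : ℤ) else 0) - (if e.2 ∈ D then 1 else 0)) =
      (T.filter (· ∈ D)).card := by
  set A : Finset V := (F.image Prod.fst ∪ F.image Prod.snd ∪ T).filter (· ∈ D) with hA
  have h1 : ∑ z ∈ A, netOut F z =
      ∑ e ∈ F, ((if e.1 ∈ D then (1 : ℤ) else 0) - (if e.2 ∈ D then 1 else 0)) := by
    simp only [netOut]
    rw [Finset.sum_comm]
    refine Finset.sum_congr rfl fun e he => ?_
    have m1 : e.1 ∈ A ↔ e.1 ∈ D := by
      simp only [hA, Finset.mem_filter, Finset.mem_union, Finset.mem_image]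
      exact ⟨fun h => h.2, fun h => ⟨Or.inl (Or.inl ⟨e, he, rfl⟩), h⟩⟩
    have m2 : e.2 ∈ A ↔ e.2 ∈ D := by
      simp only [hA, Finset.mem_filter, Finset.mem_union, Finset.mem_image]
      exact ⟨fun h => h.2, fun h => ⟨Or.inl (Or.inr ⟨e, he, rfl⟩), h⟩⟩
    rw [Finset.sum_sub_distrib, Finset.sum_ite_eq, Finset.sum_ite_eq]
    simp only [m1, m2]
  have h2 : ∑ z ∈ A, netOut F z = ∑ z ∈ A, if z ∈ T then 1 else 0 :=
    Finset.sum_congr rfl fun z hz => hF z fun h => hbD (h ▸ (Finset.mem_filter.1 hz).2)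
  rw [← h1, h2, Finset.sum_boole]
  congr 2
  ext z
  simp only [hA, Finset.mem_filter, Finset.mem_union]
  tauto

open scoped Classical in
theorem reflTransGen_of_netOut {b t : V} {T : Finset V} (ht : t ∈ T)
    {F : Finset (V × V)} (hF : ∀ z, z ≠ b → netOut F z = if z ∈ T then 1 else 0) :
    Relation.ReflTransGen (fun x y => (x, y) ∈ F) t b := by
  by_contra hb
  set D : Set V := {z | Relation.ReflTransGen (fun x y => (x, y) ∈ F) t z}
  have h := sum_crossing_eq_card hF (D := D) hb
  have hneg : ∑ e ∈ F, ((if e.1 ∈ D then (1 : ℤ) else 0) - (if e.2 ∈ D then 1 else 0)) ≤ 0 := by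
    refine Finset.sum_nonpos fun e he => ?_
    by_cases h1 : e.1 ∈ D
    · have h2 : e.2 ∈ D := Relation.ReflTransGen.tail h1 he
      simp [h1, h2]
    · simp only [h1, if_false]
      split_ifs <;> norm_num
  have hpos : 0 < (T.filter (· ∈ D)).card :=
    Finset.card_pos.2 ⟨t, Finset.mem_filter.2 ⟨ht, Relation.ReflTransGen.refl⟩⟩
  omega

open scoped Classical in
/-- A finite edge set carrying one unit of flow from each vertex of `T` to `b`
decomposes into edge-disjoint paths. -/
theorem exists_disjoint_paths_of_netOut {Adj : V → V → Prop} {b : V} (T : Finset V) :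
    ∀ F : Finset (V × V), (∀ e ∈ F, Adj e.1 e.2) →
      (∀ z, z ≠ b → netOut F z = if z ∈ T then 1 else 0) →
      ∃ P : V → DiPath Adj, (∀ t ∈ T, (P t).first = t ∧ (P t).last = b ∧ (P t).edgeSet ⊆ ↑F) ∧
        ∀ s ∈ T, ∀ t ∈ T, s ≠ t → Disjoint (P s).edgeSet (P t).edgeSet := by
  induction T using Finset.induction_on with
  | empty =>
    intro F _ _
    exact ⟨fun _ => ⟨[b], by simp, List.isChain_singleton b, by simp⟩, by simp, by simp⟩
  | insert t T ht ih =>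
    intro F hAdj hF
    obtain ⟨Q, hQf, hQl⟩ := DiPath.exists_of_reflTransGen
      (reflTransGen_of_netOut (Finset.mem_insert_self t T) hF)
    have hQF : ∀ e ∈ Q.edges, e ∈ F := fun e he => List.rel_of_mem_zip_tail Q.chain e he
    have hE : Q.edges.toFinset ⊆ F := fun e he => hQF e (List.mem_toFinset.1 he)
    obtain ⟨P, hP, hPd⟩ := ih (F \ Q.edges.toFinset) (fun e he => hAdj e (Finset.mem_sdiff.1 he).1) (by
        intro z hz
        have hE' : netOut Q.edges.toFinset z = if t = z then 1 else 0 := by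
          have h := List.sum_zip_tail_sub (fun x => if x = z then (1 : ℤ) else 0) Q.verts Q.ne
          rw [netOut, DiPath.edges, List.sum_toFinset _ (List.Nodup.zip_tail Q.nodup)]
          change Q.verts.head Q.ne = t at hQf
          change Q.verts.getLast Q.ne = b at hQl
          rw [hQf, hQl, if_neg (Ne.symm hz), sub_zero] at h
          convert h
        have hsum : netOut (F \ Q.edges.toFinset) z + netOut Q.edges.toFinset z = netOut F z :=
          Finset.sum_sdiff hE
        have hFz := hF z hz
        by_cases hzt : t = z
        · subst hzt
          simp only [Finset.mem_insert_self, if_true] at hFz hE'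
          simp only [ht, if_false]
          omega
        · have : z ∈ insert t T ↔ z ∈ T := by simp [Ne.symm hzt]
          simp only [this] at hFz
          simp only [hzt, if_false] at hE'
          omega)
    let R : DiPath Adj := ⟨Q.verts, Q.ne, Q.chain.imp fun x y h => hAdj (x, y) h, Q.nodup⟩
    have hdisj : ∀ s ∈ T, Disjoint R.edgeSet (P s).edgeSet := by
      intro s hs
      rw [Set.disjoint_left]
      intro e he he'
      exact (Finset.mem_sdiff.1 ((hP s hs).2.2 he')).2 (List.mem_toFinset.2 he)
    have hne : ∀ s ∈ T, s ≠ t := fun s hs h => ht (h ▸ hs)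
    refine ⟨Function.update P t R, ?_, ?_⟩
    · intro s hs
      rcases Finset.mem_insert.1 hs with rfl | hs
      · rw [Function.update_self]
        exact ⟨hQf, hQl, hQF⟩
      · rw [Function.update_of_ne (hne s hs)]
        exact ⟨(hP s hs).1, (hP s hs).2.1,
          fun e he => (Finset.mem_sdiff.1 ((hP s hs).2.2 he)).1⟩
    · intro s hs u hu hsu
      rcases Finset.mem_insert.1 hs with hst | hs <;> rcases Finset.mem_insert.1 hu with hut | hu
      · exact absurd (hst.trans hut.symm) hsu
      · rw [hst, Function.update_self, Function.update_of_ne (hne u hu)]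
        exact hdisj u hu
      · rw [hut, Function.update_self, Function.update_of_ne (hne s hs)]
        exact (hdisj s hs).symm
      · rw [Function.update_of_ne (hne s hs), Function.update_of_ne (hne u hu)]
        exact hPd s hs u hu hsu

/-- The residual relation of a set `F` of edges: forward along unused edges, backward along
used ones. -/
def Residual (Adj : V → V → Prop) (F : Finset (V × V)) (x y : V) : Prop :=
  (Adj x y ∧ (x, y) ∉ F) ∨ (y, x) ∈ F

open scoped Classical in
/-- Augmenting along a residual path. -/
theorem exists_augmentation {Adj : V → V → Prop} :
    ∀ (l : List V) (hl : l ≠ []), l.Nodup → ∀ F : Finset (V × V), (∀ e ∈ F, Adj e.1 e.2) →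
      l.IsChain (Residual Adj F) →
      ∃ F' : Finset (V × V), (∀ e ∈ F', Adj e.1 e.2) ∧ ∀ z, netOut F' z = netOut F z +
        ((if l.head hl = z then 1 else 0) - (if l.getLast hl = z then 1 else 0))
  | [], hl, _, _, _, _ => absurd rfl hl
  | [x], _, _, F, hF, _ => ⟨F, hF, fun z => by by_cases h : x = z <;> simp [h]⟩
  | x :: y :: l, _, hn, F, hF, hc => by
    rw [List.isChain_cons_cons] at hc
    rw [List.nodup_cons] at hn
    obtain ⟨F₁, hF₁, hnet, hsame⟩ : ∃ F₁ : Finset (V × V), (∀ e ∈ F₁, Adj e.1 e.2) ∧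
        (∀ z, netOut F₁ z = netOut F z + ((if x = z then 1 else 0) - (if y = z then 1 else 0))) ∧
        ∀ u w, u ≠ x → w ≠ x → ((u, w) ∈ F₁ ↔ (u, w) ∈ F) := by
      rcases hc.1 with ⟨ha, hm⟩ | hm
      · refine ⟨insert (x, y) F, ?_, fun z => ?_, fun u w hu _ => ?_⟩
        · intro e he
          rcases Finset.mem_insert.1 he with rfl | he
          · exact ha
          · exact hF e he
        · rw [netOut, Finset.sum_insert hm, netOut]
          ring
        · simp [hu]
      · refine ⟨F.erase (y, x), fun e he => hF e (Finset.mem_of_mem_erase he), fun z => ?_,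
          fun u w _ hw => ?_⟩
        · have h := Finset.sum_erase_add F
            (fun e : V × V => ((if e.1 = z then (1 : ℤ) else 0) - (if e.2 = z then 1 else 0))) hm
          simp only [netOut]
          linarith
        · simp [hw]
    have hc' : (y :: l).IsChain (Residual Adj F₁) := by
      refine List.IsChain.imp_of_mem_imp (fun u w hu hw h => ?_) hc.2
      have hu' : u ≠ x := fun h => hn.1 (h ▸ hu)
      have hw' : w ≠ x := fun h => hn.1 (h ▸ hw)
      simpa only [Residual, hsame u w hu' hw', hsame w u hw' hu'] using h
    obtain ⟨F', hF', h⟩ := exists_augmentation (y :: l) (by simp) hn.2 F₁ hF₁ hc'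
    refine ⟨F', hF', fun z => ?_⟩
    have hz : netOut F' z = netOut F₁ z +
        ((if y = z then 1 else 0) - (if (y :: l).getLast (by simp) = z then 1 else 0)) := h z
    change netOut F' z = netOut F z +
      ((if x = z then 1 else 0) - (if (y :: l).getLast (by simp) = z then 1 else 0))
    rw [hz, hnet z]
    ring

open scoped Classical in
/-- Max-flow min-cut for unit flows from a finite vertex set `S` to `b`. -/
theorem exists_flow_or_cut (Adj : V → V → Prop) (b : V) (S : Finset V) :
    (∃ F : Finset (V × V), (∀ e ∈ F, Adj e.1 e.2) ∧
      ∀ z, z ≠ b → netOut F z = if z ∈ S then 1 else 0) ∨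
    ∃ D : Set V, b ∉ D ∧ (Cross Adj D).Finite ∧
      (Cross Adj D).ncard < (S.filter (· ∈ D)).card := by
  induction S using Finset.induction_on with
  | empty => exact Or.inl ⟨∅, by simp, by simp [netOut]⟩
  | insert s S hs ih =>
    rcases ih with ⟨F, hF, hnet⟩ | ⟨D, hbD, hfin, hlt⟩
    · by_cases hr : Relation.ReflTransGen (Residual Adj F) s b
      · left
        obtain ⟨Q, hQf, hQl⟩ := DiPath.exists_of_reflTransGen hr
        change Q.verts.head Q.ne = s at hQf
        change Q.verts.getLast Q.ne = b at hQl
        obtain ⟨F', hF', h⟩ := exists_augmentation Q.verts Q.ne Q.nodup F hF Q.chain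
        refine ⟨F', hF', fun z hz => ?_⟩
        rw [h z, hnet z hz, hQf, hQl, if_neg (Ne.symm hz)]
        by_cases hzs : s = z
        · subst hzs
          simp [hs]
        · simp [hzs, Ne.symm hzs]
      · right
        set D : Set V := {z | Relation.ReflTransGen (Residual Adj F) s z}
        have hsD : s ∈ D := Relation.ReflTransGen.refl
        have hcross : Cross Adj D = ↑(F.filter fun e => e.1 ∈ D ∧ e.2 ∉ D) := by
          ext e
          simp only [Cross, Set.mem_ofPred_eq, Finset.coe_filter]
          refine ⟨fun h => ⟨?_, h.2⟩, fun h => ⟨hF e h.1, h.2⟩⟩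
          by_contra he
          exact h.2.2 (Relation.ReflTransGen.tail h.2.1 (Or.inl ⟨h.1, he⟩))
        have hsum := sum_crossing_eq_card hnet (D := D) hr
        have hcount : ∑ e ∈ F, ((if e.1 ∈ D then (1 : ℤ) else 0) - (if e.2 ∈ D then 1 else 0)) =
            (F.filter fun e => e.1 ∈ D ∧ e.2 ∉ D).card := by
          rw [← Finset.sum_boole]
          refine Finset.sum_congr rfl fun e he => ?_
          by_cases h2 : e.2 ∈ D
          · have h1 : e.1 ∈ D := Relation.ReflTransGen.tail h2 (Or.inr he)
            simp [h1, h2]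
          · by_cases h1 : e.1 ∈ D <;> simp [h1, h2]
        refine ⟨D, hr, hcross ▸ Finset.finite_toSet _, ?_⟩
        rw [hcross, Set.ncard_coe_finset, Finset.filter_insert, if_pos hsD,
          Finset.card_insert_of_notMem (fun h => hs (Finset.mem_filter.1 h).1)]
        omega
    · refine Or.inr ⟨D, hbD, hfin, hlt.trans_le (Finset.card_le_card ?_)⟩
      exact Finset.filter_subset_filter _ (Finset.subset_insert _ _)

open scoped Classical in
/-- The edge version of Menger's theorem for a finite set of sources. -/
theorem finLinked_or_exists_cut (Adj : V → V → Prop) (b : V) (S : Finset V) :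
    FinLinked Adj b S ∨ ∃ D : Set V, b ∉ D ∧ (Cross Adj D).Finite ∧
      (Cross Adj D).ncard < (S.filter (· ∈ D)).card := by
  refine (exists_flow_or_cut Adj b S).imp_left ?_
  rintro ⟨F, hF, hnet⟩
  obtain ⟨P, hP, hd⟩ := exists_disjoint_paths_of_netOut S F hF hnet
  exact ⟨fun s => P s, fun s => (hP s s.2).1, fun s => (hP s s.2).2.1,
    fun s t hst => hd s s.2 t t.2 fun h => hst (Subtype.ext h)⟩

theorem FinLinked.card_le_ncard_cross {Adj : V → V → Prop} {b : V} {S : Finset V}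
    (h : FinLinked Adj b S) {D : Set V} (hSD : ↑S ⊆ D) (hb : b ∉ D)
    (hfin : (Cross Adj D).Finite) : S.card ≤ (Cross Adj D).ncard := by
  obtain ⟨P, hf, hl, hd⟩ := h
  have key : ∀ s : S, ∃ e ∈ (P s).edgeSet, e ∈ Cross Adj D := by
    intro s
    obtain ⟨e, he, hc⟩ := List.exists_mem_zip_tail_crossing D (P s).verts (P s).ne
      (by have := hf s; rw [DiPath.first] at this; rw [this]; exact hSD s.2)
      (by have := hl s; rw [DiPath.last] at this; rw [this]; exact hb)
    exact ⟨e, he, List.rel_of_mem_zip_tail (P s).chain e he, hc⟩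
  choose c hcP hcC using key
  have hinj : Function.Injective fun s => (⟨c s, hcC s⟩ : Cross Adj D) := by
    intro s t hst
    by_contra hne
    have hst' : c s = c t := congrArg Subtype.val hst
    exact Set.disjoint_left.1 (hd s t hne) (hcP s) (hst' ▸ hcP t)
  have := hfin.to_subtype
  simpa [Nat.card_coe_set_eq] using Nat.card_le_card_of_injective _ hinj

end EdgeMenger

theorem stmt6 {V : Type*} (Adj : V → V → Prop) (b : V) (I : Set V) (hb : b ∉ I)
    (hlink : ∀ S : Finset V, ↑S ⊆ I → FinLinked Adj b S)
    (hmax : ∀ J : Set V, I ⊆ J → b ∉ J →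
      (∀ S : Finset V, ↑S ⊆ J → FinLinked Adj b S) → J = I)
    (v : V) (hv : v ≠ b) (hvI : v ∉ I) :
    ∃ D : Set V, Exact Adj b I D ∧ v ∈ D := by
  classical
  have hbJ : b ∉ insert v I := by
    rintro (h | h)
    · exact hv h.symm
    · exact hb h
  obtain ⟨S, hSI, hS⟩ : ∃ S : Finset V, ↑S ⊆ insert v I ∧ ¬ FinLinked Adj b S := by
    by_contra! h
    exact hvI (hmax _ (Set.subset_insert v I) hbJ h ▸ Set.mem_insert v I)
  obtain ⟨D, hbD, hfin, hlt⟩ :=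
    (finLinked_or_exists_cut Adj b S).resolve_left hS
  have hbound : ∀ A : Finset V, ↑A ⊆ D ∩ I → A.card ≤ (Cross Adj D).ncard := fun A hA =>
    (hlink A fun x hx => (hA hx).2).card_le_ncard_cross (fun x hx => (hA hx).1) hbD hfin
  have hDI : (D ∩ I).Finite := by
    by_contra hinf
    obtain ⟨A, hA, hcard⟩ := Set.Infinite.exists_subset_card_eq hinf ((Cross Adj D).ncard + 1)
    have := hbound A hA
    omega
  have hle : (D ∩ I).ncard ≤ (Cross Adj D).ncard := by
    rw [Set.ncard_eq_toFinset_card _ hDI]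
    exact hbound _ (by simp)
  have hsub : (↑((S.filter (· ∈ D)).erase v) : Set V) ⊆ D ∩ I := by
    intro x hx
    obtain ⟨hxv, hx⟩ := Finset.mem_erase.1 hx
    obtain ⟨hxS, hxD⟩ := Finset.mem_filter.1 hx
    exact ⟨hxD, (hSI hxS).resolve_left hxv⟩
  have hge : ((S.filter (· ∈ D)).erase v).card ≤ (D ∩ I).ncard := by
    rw [← Set.ncard_coe_finset]
    exact Set.ncard_le_ncard hsub hDI
  have hvD : v ∈ S.filter (· ∈ D) := by
    by_contra h
    rw [Finset.erase_eq_of_notMem h] at hge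
    omega
  rw [Finset.card_erase_of_mem hvD] at hge
  exact ⟨D, ⟨hbD, hfin, hDI, by omega⟩, (Finset.mem_filter.1 hvD).2⟩
end

section
/- Let G be an infinite digraph with vertex sets A and B. Then there exists a family of pairwise vertex-disjoint directed paths or rays (Q_a | a ∈ A), where Q_a starts at a and either ends at a vertex of B or dominates B, if and only if every finite subset of A can be linked to B by pairwise vertex-disjoint directed paths. -/
/-- A vertex `v` dominates the set `B` (vertex version): there are infinitely many
directed `v`–`B` paths, pairwise vertex-disjoint except in `v`. -/
def VDomSet {V : Type*} (Adj : V → V → Prop) (B : Set V) (v : V) : Prop :=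
  ∃ P : ℕ → DiPath Adj, Function.Injective P ∧ (∀ n, (P n).first = v) ∧
    (∀ n, (P n).last ∈ B) ∧
    ∀ m n, m ≠ n → ∀ x ∈ (P m).vertexSet, x ∈ (P n).vertexSet → x = v

/-- A ray `R` dominates the set `B`: there are infinitely many pairwise
vertex-disjoint directed paths from `R` to `B`. -/
def RDomSet {V : Type*} (Adj : V → V → Prop) (B : Set V) (R : DiRay Adj) : Prop :=
  ∃ P : ℕ → DiPath Adj, Function.Injective P ∧ (∀ n, (P n).first ∈ R.vertexSet) ∧
    (∀ n, (P n).last ∈ B) ∧ ∀ m n, m ≠ n → Disjoint (P m).vertexSet (P n).vertexSet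

/-- A path or ray is good for `B` (vertex version): it ends in `B` or dominates `B`
(a path dominates `B` if its last vertex does). -/
def PR.GoodV {V : Type*} {Adj : V → V → Prop} (B : Set V) : PR Adj → Prop
  | .path P => P.last ∈ B ∨ VDomSet Adj B P.last
  | .ray R => RDomSet Adj B R

/-- A domination linkage (vertex version) from `A` to `B`: pairwise vertex-disjoint
directed paths or rays, one starting at each vertex of `A`, each ending in `B`
or dominating `B`. -/
def VDomLinkage {V : Type*} (Adj : V → V → Prop) (A B : Set V) : Prop :=
  ∃ Q : A → PR Adj, (∀ a : A, (Q a).first = (a : V)) ∧ (∀ a, (Q a).GoodV B) ∧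
    ∀ a a' : A, a ≠ a' → Disjoint (Q a).vertexSet (Q a').vertexSet

/-- The finite set `S` can be linked to `B` by pairwise vertex-disjoint directed
paths, one starting at each vertex of `S`, each ending in `B`. -/
def VFinLinked {V : Type*} (Adj : V → V → Prop) (B : Set V) (S : Finset V) : Prop :=
  ∃ P : S → DiPath Adj, (∀ s, (P s).first = (s : V)) ∧ (∀ s, (P s).last ∈ B) ∧
    ∀ s t, s ≠ t → Disjoint (P s).vertexSet (P t).vertexSet

/-- `𝓛(G, B)`: the collection of vertex sets that can be linked to `B` by
pairwise vertex-disjoint directed paths. -/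
def LGB {V : Type*} (Adj : V → V → Prop) (B : Set V) : Set (Set V) :=
  {I | ∃ P : I → DiPath Adj, (∀ v : I, (P v).first = (v : V)) ∧
    (∀ v, (P v).last ∈ B) ∧
    ∀ v w : I, v ≠ w → Disjoint (P v).vertexSet (P w).vertexSet}

namespace DomLinkage

open Relation

open scoped Classical in
/-- A family of finite sets without a transversal of fewer than `k` elements has a finite
subfamily without such a transversal. -/
theorem exists_finset_forall_disjoint {α : Type*} (F : Set (Finset α)) (k : ℕ)
    (h : ∀ X : Finset α, X.card < k → ∃ P ∈ F, Disjoint P X) :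
    ∃ W : Finset α, ∀ X : Finset α, X.card < k → ∃ P ∈ F, P ⊆ W ∧ Disjoint P X := by
  suffices H : ∀ n : ℕ, ∀ Y : Finset α, k ≤ Y.card + n →
      ∃ W : Finset α, ∀ X : Finset α, Y ⊆ X → X.card < k → ∃ P ∈ F, P ⊆ W ∧ Disjoint P X by
    obtain ⟨W, hW⟩ := H k ∅ (by simp)
    exact ⟨W, fun X hX => hW X (Finset.empty_subset X) hX⟩
  intro n
  induction n with
  | zero =>
    intro Y hY
    refine ⟨∅, fun X hYX hX => ?_⟩
    have := Finset.card_le_card hYX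
    omega
  | succ n ih =>
    intro Y hY
    by_cases hk : Y.card < k
    swap
    · exact ih Y (by omega)
    obtain ⟨P, hPF, hPY⟩ := h Y hk
    have key : ∀ p : α, ∃ W : Finset α, p ∈ P → ∀ X : Finset α, insert p Y ⊆ X → X.card < k →
        ∃ P ∈ F, P ⊆ W ∧ Disjoint P X := by
      intro p
      by_cases hp : p ∈ P
      · have hpY : p ∉ Y := Finset.disjoint_left.mp hPY hp
        obtain ⟨W, hW⟩ := ih (insert p Y) (by rw [Finset.card_insert_of_notMem hpY]; omega)
        exact ⟨W, fun _ => hW⟩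
      · exact ⟨∅, fun h => absurd h hp⟩
    choose W hW using key
    refine ⟨P ∪ P.biUnion W, fun X hYX hX => ?_⟩
    by_cases hd : Disjoint P X
    · exact ⟨P, hPF, Finset.subset_union_left, hd⟩
    · obtain ⟨p, hpP, hpX⟩ := Finset.not_disjoint_iff.mp hd
      obtain ⟨Q, hQF, hQW, hQX⟩ := hW p hpP X (Finset.insert_subset hpX hYX) hX
      exact ⟨Q, hQF, hQW.trans ((Finset.subset_biUnion_of_mem W hpP).trans
        Finset.subset_union_right), hQX⟩

variable {V : Type*}

/-- `v` can be joined to `B` by a directed walk avoiding `X`. -/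
def Reaches (Adj : V → V → Prop) (B : Set V) (X : Finset V) (v : V) : Prop :=
  v ∉ X ∧ ∃ b ∈ B, ReflTransGen (fun u w => Adj u w ∧ w ∉ X) v b

/-- The vertices that `X` separates from `B`, including `X` itself. -/
def Sep (Adj : V → V → Prop) (B : Set V) (X : Finset V) : Set V := {v | ¬ Reaches Adj B X v}

/-- The vertices outside `X` that `X` separates from `B`. -/
def SepInt (Adj : V → V → Prop) (B : Set V) (X : Finset V) : Set V := Sep Adj B X \ X

variable {Adj : V → V → Prop} {A B : Set V} {X Y Z : Finset V} {u v w : V}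

theorem Reaches.head (hvX : v ∉ X) (h : Adj v w) (hw : Reaches Adj B X w) :
    Reaches Adj B X v := by
  obtain ⟨hwX, b, hb, hwb⟩ := hw
  exact ⟨hvX, b, hb, ReflTransGen.head ⟨h, hwX⟩ hwb⟩

theorem reaches_of_mem (hvX : v ∉ X) (hv : v ∈ B) : Reaches Adj B X v :=
  ⟨hvX, v, hv, ReflTransGen.refl⟩

@[elab_as_elim]
theorem Reaches.induction {p : V → Prop} (hv : Reaches Adj B X v)
    (base : ∀ b ∈ B, b ∉ X → p b)
    (step : ∀ u w, u ∉ X → Adj u w → Reaches Adj B X w → p w → p u) : p v := by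
  obtain ⟨hvX, b, hb, h⟩ := hv
  revert hvX
  induction h using ReflTransGen.head_induction_on with
  | refl => exact base b hb
  | head h1 h2 ih => exact fun hX => step _ _ hX h1.1 ⟨h1.2, b, hb, h2⟩ (ih h1.2)

theorem subset_sep : (X : Set V) ⊆ Sep Adj B X := fun _ hv h => h.1 hv

theorem mem_sep_iff : v ∈ Sep Adj B X ↔ v ∈ SepInt Adj B X ∨ v ∈ X := by
  constructor
  · intro h
    by_cases hv : v ∈ X
    · exact Or.inr hv
    · exact Or.inl ⟨h, hv⟩
  · rintro (h | h)
    · exact h.1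
    · exact subset_sep h

theorem notMem_of_mem_sepInt (h : v ∈ SepInt Adj B X) : v ∉ B :=
  fun hB => h.1 (reaches_of_mem h.2 hB)

theorem mem_sep_of_adj (h : v ∈ SepInt Adj B X) (hw : Adj v w) : w ∈ Sep Adj B X :=
  fun hr => h.1 (hr.head h.2 hw)

theorem sep_mono (h : (X : Set V) ⊆ Sep Adj B Y) : Sep Adj B X ⊆ Sep Adj B Y := by
  intro v hv hr
  refine hv (hr.induction (fun b hb hbY => ?_) (fun u w huY huw hw ih => ?_))
  · exact reaches_of_mem (fun hbX => h hbX (reaches_of_mem hbY hb)) hb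
  · exact ih.head (fun huX => h huX (hw.head huY huw)) huw

/-- A set avoiding `B` whose out-neighbours outside it all lie in `X` is separated by `X`. -/
theorem subset_sep_of_closed {E : Set V} (hE : ∀ v ∈ E, v ∉ B)
    (h : ∀ v ∈ E, ∀ w, Adj v w → w ∈ E ∨ w ∈ X) : E ⊆ Sep Adj B X := by
  intro v hv hr
  revert hv
  refine hr.induction (fun b hb _ hbE => hE b hbE hb) (fun u w _ huw hw ih hu => ?_)
  exact ih ((h u hu w huw).resolve_right hw.1)

open scoped Classical in
/-- The separator of the union of the sides of two separators. -/
noncomputable def join (Adj : V → V → Prop) (B : Set V) (X Y : Finset V) : Finset V :=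
  (X ∪ Y).filter fun v => v ∉ SepInt Adj B X ∧ v ∉ SepInt Adj B Y

open scoped Classical in
/-- The separator of the intersection of the sides of two separators. -/
noncomputable def meet (Adj : V → V → Prop) (B : Set V) (X Y : Finset V) : Finset V :=
  (X ∪ Y).filter fun v => v ∈ Sep Adj B X ∧ v ∈ Sep Adj B Y

theorem mem_join : v ∈ join Adj B X Y ↔
    (v ∈ X ∨ v ∈ Y) ∧ v ∉ SepInt Adj B X ∧ v ∉ SepInt Adj B Y := by
  simp [join]

theorem mem_meet : v ∈ meet Adj B X Y ↔
    (v ∈ X ∨ v ∈ Y) ∧ v ∈ Sep Adj B X ∧ v ∈ Sep Adj B Y := by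
  simp [meet]

theorem card_join_add_card_meet :
    (join Adj B X Y).card + (meet Adj B X Y).card = X.card + Y.card := by
  classical
  rw [← Finset.card_union_add_card_inter, ← Finset.card_union_add_card_inter X Y]
  have hX : ∀ {v}, v ∈ X → v ∉ SepInt Adj B X := fun h h' => h'.2 h
  have hY : ∀ {v}, v ∈ Y → v ∉ SepInt Adj B Y := fun h h' => h'.2 h
  congr 2
  · ext v
    simp only [Finset.mem_union, mem_join, mem_meet, mem_sep_iff]
    have := @hX v
    have := @hY v
    tauto
  · ext v
    simp only [Finset.mem_inter, mem_join, mem_meet, mem_sep_iff]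
    have := @hX v
    have := @hY v
    tauto

theorem sepInt_union_subset_join :
    SepInt Adj B X ∪ SepInt Adj B Y ⊆ SepInt Adj B (join Adj B X Y) := by
  have h : SepInt Adj B X ∪ SepInt Adj B Y ⊆ Sep Adj B (join Adj B X Y) := by
    refine subset_sep_of_closed ?_ ?_
    · rintro v (hv | hv) <;> exact notMem_of_mem_sepInt hv
    · intro v hv w hvw
      have : w ∈ Sep Adj B X ∨ w ∈ Sep Adj B Y :=
        hv.imp (fun h => mem_sep_of_adj h hvw) (fun h => mem_sep_of_adj h hvw)
      simp only [mem_sep_iff] at this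
      rw [Set.mem_union, mem_join]
      tauto
  intro v hv
  refine ⟨h hv, fun hj => ?_⟩
  have := (mem_join.mp hj).2
  exact hv.elim this.1 this.2

theorem sep_union_subset_join :
    Sep Adj B X ∪ Sep Adj B Y ⊆ Sep Adj B (join Adj B X Y) := by
  intro v hv
  rw [Set.mem_union, mem_sep_iff, mem_sep_iff] at hv
  have := @sepInt_union_subset_join _ Adj B X Y v
  rw [Set.mem_union] at this
  rw [mem_sep_iff, mem_join]
  tauto

theorem sep_meet : Sep Adj B (meet Adj B X Y) = Sep Adj B X ∩ Sep Adj B Y := by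
  apply Set.Subset.antisymm
  · exact Set.subset_inter (sep_mono fun v hv => (mem_meet.mp hv).2.1)
      (sep_mono fun v hv => (mem_meet.mp hv).2.2)
  · have h : SepInt Adj B X ∩ SepInt Adj B Y ⊆ Sep Adj B (meet Adj B X Y) := by
      refine subset_sep_of_closed (fun v hv => notMem_of_mem_sepInt hv.1) fun v hv w hvw => ?_
      have h1 := mem_sep_of_adj hv.1 hvw
      have h2 := mem_sep_of_adj hv.2 hvw
      rw [mem_meet, Set.mem_inter_iff]
      have := mem_sep_iff.mp h1
      have := mem_sep_iff.mp h2
      tauto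
    rintro v ⟨h1, h2⟩
    by_cases hv : v ∈ X ∨ v ∈ Y
    · exact subset_sep (mem_meet.mpr ⟨hv, h1, h2⟩)
    · exact h ⟨⟨h1, fun h => hv (Or.inl h)⟩, ⟨h2, fun h => hv (Or.inr h)⟩⟩

theorem sepInt_meet : SepInt Adj B (meet Adj B X Y) = SepInt Adj B X ∩ SepInt Adj B Y := by
  ext v
  simp only [SepInt, sep_meet, Set.mem_sdiff, Set.mem_inter_iff, Finset.mem_coe, mem_meet]
  tauto

/-! ### Menger's theorem for a finite set of sources -/

/-- A linkage of `S` to `B`, given as a successor function on a finite set of vertices. Cycles and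
fixed points disjoint from the paths starting in `S` are allowed. -/
def IsFlow (Adj : V → V → Prop) (B : Set V) (S U : Finset V) (f : V → V) : Prop :=
  S ⊆ U ∧ Set.InjOn f (U \ B : Set V) ∧
    ∀ u ∈ U, u ∉ B → f u ∈ U ∧ f u ∉ S ∧ (f u = u ∨ Adj u (f u))

theorem Reaches.exists_finset (h : Reaches Adj B X v) : ∃ P : Finset V, v ∈ P ∧ Disjoint P X ∧
    ∃ b ∈ B, ReflTransGen (fun u w => Adj u w ∧ w ∈ P) v b := by
  classical
  refine h.induction (fun b hb hbX => ⟨{b}, by simp, by simpa, b, hb, .refl⟩) ?_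
  rintro u w huX huw - ⟨P, hwP, hPX, b, hb, hwb⟩
  refine ⟨insert u P, by simp, Finset.disjoint_insert_left.mpr ⟨huX, hPX⟩, b, hb, ?_⟩
  refine ReflTransGen.head ⟨huw, Finset.mem_insert_of_mem hwP⟩ ?_
  have hle : (fun x y => Adj x y ∧ y ∈ P) ≤ fun x y => Adj x y ∧ y ∈ insert u P :=
    fun x y hxy => ⟨hxy.1, Finset.mem_insert_of_mem hxy.2⟩
  exact ReflTransGen.mono hle _ _ hwb

/-- If fewer than `#S` vertices never separate `S` from `B`, then `S` can be linked to `B`. -/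
theorem exists_isFlow (S : Finset V)
    (h : ∀ X : Finset V, X.card < S.card → ∃ s ∈ S, Reaches Adj B X s) :
    ∃ U f, IsFlow Adj B S U f := by
  classical
  obtain ⟨W₀, hW₀⟩ := exists_finset_forall_disjoint
    {P : Finset V | ∃ s ∈ S, s ∈ P ∧ ∃ b ∈ B, ReflTransGen (fun u w => Adj u w ∧ w ∈ P) s b}
    S.card (fun X hX => by
      obtain ⟨s, hs, hr⟩ := h X hX
      obtain ⟨P, hsP, hPX, hP⟩ := hr.exists_finset
      exact ⟨P, ⟨s, hs, hsP, hP⟩, hPX⟩)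
  set W := W₀ ∪ S with hW
  let t : {v // v ∈ W ∧ v ∉ B} → Finset V := fun v =>
    W.filter fun w => w ∉ S ∧ (w = v ∨ Adj v w)
  have hall : ∀ T : Finset {v // v ∈ W ∧ v ∉ B}, T.card ≤ (T.biUnion t).card := by
    intro T
    by_contra! hlt
    let T' : Finset V := T.map (Function.Embedding.subtype _)
    have hT' : ∀ v ∈ T', v ∈ W ∧ v ∉ B := by
      intro v hv
      obtain ⟨x, -, rfl⟩ := Finset.mem_map.mp hv
      exact x.2
    let N : Finset V := W.filter fun w => ∃ v ∈ T', w = v ∨ Adj v w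
    have hTN : T' ⊆ N := fun v hv => Finset.mem_filter.mpr ⟨(hT' v hv).1, v, hv, Or.inl rfl⟩
    have hN : T.biUnion t = N \ S := by
      ext w
      simp only [Finset.mem_biUnion, t, N, T', Finset.mem_filter, Finset.mem_sdiff,
        Finset.mem_map, Function.Embedding.subtype_apply]
      constructor
      · rintro ⟨x, hx, hw, hwS, hxw⟩
        exact ⟨⟨hw, x, ⟨x, hx, rfl⟩, hxw⟩, hwS⟩
      · rintro ⟨⟨hw, -, ⟨x, hx, rfl⟩, hxw⟩, hwS⟩
        exact ⟨x, hx, hw, hwS, hxw⟩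
    have hcard : ((N \ T') ∪ (S \ N)).card < S.card := by
      have h1 := Finset.card_sdiff_add_card_inter N S
      have h2 := Finset.card_sdiff_add_card_inter S N
      have h3 := Finset.card_sdiff_add_card_eq_card hTN
      have h4 := Finset.card_union_le (N \ T') (S \ N)
      have h5 : T'.card = T.card := Finset.card_map _
      rw [Finset.inter_comm] at h2
      rw [hN] at hlt
      omega
    obtain ⟨P, ⟨s, hs, hsP, b, hb, hsb⟩, hPW, hPX⟩ := hW₀ _ hcard
    have hPX' : ∀ v ∈ P, v ∉ N \ T' ∧ v ∉ S \ N := fun v hv => by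
      simpa only [Finset.mem_union, not_or] using Finset.disjoint_left.mp hPX hv
    have hPT : ∀ v ∈ P, v ∈ N → v ∈ T' := fun v hv hvN => by
      by_contra hvT
      exact (hPX' v hv).1 (Finset.mem_sdiff.mpr ⟨hvN, hvT⟩)
    have hsT : s ∈ T' := by
      refine hPT s hsP ?_
      by_contra hsN
      exact (hPX' s hsP).2 (Finset.mem_sdiff.mpr ⟨hs, hsN⟩)
    have hbT : b ∈ T' := by
      clear hb
      induction hsb with
      | refl => exact hsT
      | tail _ hvw ih =>
        exact hPT _ hvw.2 (Finset.mem_filter.mpr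
          ⟨Finset.mem_union_left _ (hPW hvw.2), _, ih, Or.inr hvw.1⟩)
    exact (hT' b hbT).2 hb
  obtain ⟨g, hg, hgt⟩ := (Finset.all_card_le_biUnion_card_iff_exists_injective t).mp hall
  have hgt' : ∀ x, g x ∈ W ∧ g x ∉ S ∧ (g x = x ∨ Adj x (g x)) := fun x =>
    Finset.mem_filter.mp (hgt x)
  refine ⟨W, fun v => if hv : v ∈ W ∧ v ∉ B then g ⟨v, hv⟩ else v,
    Finset.subset_union_right, ?_, ?_⟩
  · intro v hv w hw hvw
    have hv' : v ∈ W ∧ v ∉ B := hv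
    have hw' : w ∈ W ∧ w ∉ B := hw
    simp only [dif_pos hv', dif_pos hw'] at hvw
    exact congrArg Subtype.val (hg hvw)
  · intro u hu huB
    have hu' : u ∈ W ∧ u ∉ B := ⟨hu, huB⟩
    simpa only [dif_pos hu'] using hgt' ⟨u, hu'⟩

/-! ### Orbits of successor functions -/

theorem orbit_injective {f : V → V} {N S : Set V} (hf : Set.InjOn f N) (hS : ∀ v ∈ N, f v ∉ S)
    {a a' : V} (ha : a ∈ S) (ha' : a' ∈ S) : ∀ {i j : ℕ}, (∀ k < i, f^[k] a ∈ N) →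
      (∀ k < j, f^[k] a' ∈ N) → f^[i] a = f^[j] a' → i = j ∧ a = a'
  | 0, 0, _, _, h => ⟨rfl, h⟩
  | 0, j + 1, _, hj, h => by
    rw [Function.iterate_succ_apply'] at h
    exact absurd (h ▸ ha) (hS _ (hj j j.lt_succ_self))
  | i + 1, 0, hi, _, h => by
    rw [Function.iterate_succ_apply'] at h
    exact absurd (h ▸ ha') (hS _ (hi i i.lt_succ_self))
  | i + 1, j + 1, hi, hj, h => by
    rw [Function.iterate_succ_apply', Function.iterate_succ_apply'] at h
    have := orbit_injective hf hS ha ha' (fun k hk => hi k (hk.trans i.lt_succ_self))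
      (fun k hk => hj k (hk.trans j.lt_succ_self))
      (hf (hi i i.lt_succ_self) (hj j j.lt_succ_self) h)
    exact ⟨congrArg _ this.1, this.2⟩

/-- The path consisting of the first `n + 1` terms of a sequence. -/
def pathOfSeq (o : ℕ → V) (n : ℕ) (hadj : ∀ i < n, Adj (o i) (o (i + 1)))
    (hinj : ∀ i ≤ n, ∀ j ≤ n, o i = o j → i = j) : DiPath Adj where
  verts := (List.range (n + 1)).map o
  ne := by simp
  chain := by
    rw [List.Chain', List.isChain_iff_getElem]
    intro i hi
    simpa using hadj i (by simpa using hi)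
  nodup := by
    refine List.Nodup.map_on (fun i hi j hj h => ?_) List.nodup_range
    rw [List.mem_range, Nat.lt_succ_iff] at hi hj
    exact hinj i hi j hj h

section pathOfSeq
variable {o : ℕ → V} {n : ℕ} {hadj : ∀ i < n, Adj (o i) (o (i + 1))}
  {hinj : ∀ i ≤ n, ∀ j ≤ n, o i = o j → i = j}

theorem pathOfSeq_first : (pathOfSeq o n hadj hinj).first = o 0 := by
  simp [pathOfSeq, DiPath.first]

theorem pathOfSeq_last : (pathOfSeq o n hadj hinj).last = o n := by
  simp [pathOfSeq, DiPath.last]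

theorem mem_vertexSet_pathOfSeq :
    v ∈ (pathOfSeq o n hadj hinj).vertexSet ↔ ∃ i ≤ n, o i = v := by
  simp [pathOfSeq, DiPath.vertexSet]

end pathOfSeq

theorem IsFlow.vFinLinked {S U : Finset V} {f : V → V} (h : IsFlow Adj B S U f) :
    VFinLinked Adj B S := by
  classical
  obtain ⟨hSU, hinj, hstep⟩ := h
  have hN : ∀ v ∈ (U \ B : Set V), f v ∉ (S : Set V) := fun v hv => (hstep v hv.1 hv.2).2.1
  have hmem : ∀ s ∈ S, ∀ n, (∀ k < n, f^[k] s ∉ B) → f^[n] s ∈ U := by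
    intro s hs n
    induction n with
    | zero => exact fun _ => hSU hs
    | succ n ih =>
      intro hn
      rw [Function.iterate_succ_apply']
      exact (hstep _ (ih fun k hk => hn k (by omega)) (hn n (by omega))).1
  have key : ∀ s ∈ S, ∀ s' ∈ S, ∀ i j, (∀ k < i, f^[k] s ∉ B) → (∀ k < j, f^[k] s' ∉ B) →
      f^[i] s = f^[j] s' → i = j ∧ s = s' := by
    intro s hs s' hs' i j hi hj
    exact orbit_injective hinj hN hs hs'
      (fun k hk => ⟨hmem s hs k fun l hl => hi l (by omega), hi k hk⟩)
      (fun k hk => ⟨hmem s' hs' k fun l hl => hj l (by omega), hj k hk⟩)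
  have hex : ∀ s ∈ S, ∃ n, f^[n] s ∈ B := by
    intro s hs
    by_contra! hno
    have hi : Function.Injective fun n => f^[n] s := fun i j hij =>
      (key s hs s hs i j (fun k _ => hno k) (fun k _ => hno k) hij).1
    exact Set.infinite_range_of_injective hi
      (U.finite_toSet.subset (Set.range_subset_iff.mpr fun n => hmem s hs n fun k _ => hno k))
  have hlt : ∀ s : S, ∀ i ≤ Nat.find (hex s s.2), ∀ k < i, f^[k] (s : V) ∉ B :=
    fun s i hi k hk => Nat.find_min (hex s s.2) (by omega)
  have hadj : ∀ s : S, ∀ i < Nat.find (hex s s.2), Adj (f^[i] (s : V)) (f^[i + 1] (s : V)) := by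
    intro s i hi
    have h1 := (hstep _ (hmem s s.2 i (hlt s i hi.le)) (Nat.find_min (hex s s.2) hi)).2.2
    rw [← Function.iterate_succ_apply' f] at h1
    refine h1.resolve_left fun he => ?_
    have := (key s s.2 s s.2 _ _ (hlt s (i + 1) hi) (hlt s i hi.le) he).1
    omega
  refine ⟨fun s => pathOfSeq (fun i => f^[i] (s : V)) (Nat.find (hex s s.2)) (hadj s)
    (fun i hi j hj he => (key s s.2 s s.2 i j (hlt s i hi) (hlt s j hj) he).1), ?_, ?_, ?_⟩
  · exact fun s => pathOfSeq_first
  · intro s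
    rw [pathOfSeq_last]
    exact Nat.find_spec (hex s s.2)
  · intro s s' hss'
    refine Set.disjoint_left.mpr fun v hv hv' => ?_
    obtain ⟨i, hi, rfl⟩ := mem_vertexSet_pathOfSeq.mp hv
    obtain ⟨j, hj, he⟩ := mem_vertexSet_pathOfSeq.mp hv'
    exact hss' (Subtype.ext (key s s.2 s' s'.2 i j (hlt s i hi) (hlt s' j hj) he.symm).2)

/-! ### Paths and reachability -/

theorem reaches_of_reaches_getLast : ∀ {l : List V} (hl : l ≠ []), l.IsChain Adj →
    (∀ x ∈ l, x ∉ X) → Reaches Adj B X (l.getLast hl) → ∀ x ∈ l, Reaches Adj B X x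
  | [a], _, _, _, hB, x, hx => by
    obtain rfl := List.mem_singleton.mp hx
    exact hB
  | a :: b :: l, _, hc, hX, hB, x, hx => by
    rw [List.isChain_cons_cons] at hc
    have ih := reaches_of_reaches_getLast (List.cons_ne_nil b l) hc.2
      (fun y hy => hX y (List.mem_cons_of_mem a hy)) (by simpa using hB)
    rcases List.mem_cons.mp hx with rfl | hx
    · exact (ih b (by simp)).head (hX x (by simp)) hc.1
    · exact ih x hx

theorem reaches_of_reaches_last {P : DiPath Adj} (h : Reaches Adj B X P.last)
    (hX : ∀ x ∈ P.vertexSet, x ∉ X) (hv : v ∈ P.vertexSet) : Reaches Adj B X v :=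
  reaches_of_reaches_getLast P.ne P.chain hX h v hv

theorem first_mem_vertexSet (P : DiPath Adj) : P.first ∈ P.vertexSet :=
  List.head_mem P.ne

theorem last_mem_vertexSet (P : DiPath Adj) : P.last ∈ P.vertexSet :=
  List.getLast_mem P.ne

theorem reaches_of_mem_path {P : DiPath Adj} (hB : P.last ∈ B)
    (hX : ∀ x ∈ P.vertexSet, x ∉ X) (hv : v ∈ P.vertexSet) : Reaches Adj B X v :=
  reaches_of_reaches_last (reaches_of_mem (hX _ (last_mem_vertexSet P)) hB) hX hv

theorem Reaches.exists_path (h : Reaches Adj B X v) : ∃ P : DiPath Adj, P.first = v ∧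
    P.last ∈ B ∧ ∀ x ∈ P.vertexSet, x ∉ X := by
  refine h.induction (fun b hb hbX => ⟨⟨[b], by simp, List.isChain_singleton b, by simp⟩, rfl, hb,
    by simpa [DiPath.vertexSet] using hbX⟩) ?_
  rintro u w huX huw - ⟨P, hPw, hPB, hPX⟩
  by_cases hu : u ∈ P.verts
  · obtain ⟨s, t, hst⟩ := List.append_of_mem hu
    have hsuf : (u :: t) <:+ P.verts := ⟨s, hst.symm⟩
    refine ⟨⟨u :: t, by simp, List.IsChain.suffix P.chain hsuf, P.nodup.sublist hsuf.sublist⟩,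
      rfl, ?_, fun x hx => hPX x (hsuf.subset hx)⟩
    have : P.last = (u :: t).getLast (by simp) := by
      simp only [DiPath.last, hst]
      exact List.getLast_append_of_ne_nil _ _
    rwa [this] at hPB
  · refine ⟨⟨u :: P.verts, by simp, ?_, List.nodup_cons.mpr ⟨hu, P.nodup⟩⟩, rfl, ?_, ?_⟩
    · refine List.IsChain.cons P.chain ?_
      intro y hy
      rw [List.head?_eq_some_head P.ne, Option.mem_some_iff] at hy
      have : P.verts.head P.ne = w := hPw
      rwa [← hy, this]
    · have : (u :: P.verts).getLast (by simp) = P.last := List.getLast_cons P.ne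
      rwa [← this] at hPB
    · rintro x (_ | ⟨_, hx⟩)
      · exact huX
      · exact hPX x hx

theorem exists_seq_paths (C : Set V) (p : DiPath Adj → Prop)
    (h : ∀ X : Finset V, Disjoint (X : Set V) C → ∃ P, p P ∧ ∀ x ∈ P.vertexSet, x ∉ X) :
    ∃ P : ℕ → DiPath Adj, (∀ n, p (P n)) ∧
      ∀ m n, m ≠ n → ∀ x ∈ (P m).vertexSet, x ∈ (P n).vertexSet → x ∈ C := by
  classical
  obtain ⟨P, hP, hd⟩ := exists_seq_of_forall_finset_exists p
    (fun P Q => ∀ x ∈ P.vertexSet, x ∈ Q.vertexSet → x ∈ C) (fun s _ => by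
      obtain ⟨P, h1, h2⟩ := h ((s.biUnion fun Q => Q.verts.toFinset).filter fun x => x ∉ C)
        (Set.disjoint_left.mpr fun x hx => (Finset.mem_filter.mp hx).2)
      refine ⟨P, h1, fun Q hQ x hxQ hxP => ?_⟩
      by_contra hxC
      exact h2 x hxP (Finset.mem_filter.mpr ⟨Finset.mem_biUnion.mpr
        ⟨Q, hQ, List.mem_toFinset.mpr hxQ⟩, hxC⟩))
  refine ⟨P, hP, fun m n hmn x hm hn => ?_⟩
  rcases hmn.lt_or_gt with h | h
  · exact hd m n h x hm hn
  · exact hd n m h x hn hm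

/-- A vertex outside `B` that reaches `B` avoiding any finite set of other vertices
dominates `B`. -/
theorem vDomSet_of_reaches (hvB : v ∉ B) (h : ∀ X : Finset V, v ∉ X → Reaches Adj B X v) :
    VDomSet Adj B v := by
  obtain ⟨P, hP, hd⟩ := exists_seq_paths {v} (fun P : DiPath Adj => P.first = v ∧ P.last ∈ B)
    (fun X hX => by
      obtain ⟨P, h1, h2, h3⟩ := (h X (by simpa using hX)).exists_path
      exact ⟨P, ⟨h1, h2⟩, h3⟩)
  refine ⟨P, fun m n hmn => ?_, fun n => (hP n).1, fun n => (hP n).2, hd⟩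
  by_contra hne
  have := hd m n hne _ (last_mem_vertexSet _) (hmn ▸ last_mem_vertexSet (P m))
  exact hvB (this ▸ (hP m).2)

/-- A ray whose vertices cannot be separated from `B` by a finite set dominates `B`. -/
theorem rDomSet_of_reaches {R : DiRay Adj} (h : ∀ X : Finset V, ∃ n, Reaches Adj B X (R.f n)) :
    RDomSet Adj B R := by
  obtain ⟨P, hP, hd⟩ := exists_seq_paths ∅
    (fun P : DiPath Adj => P.first ∈ R.vertexSet ∧ P.last ∈ B) (fun X _ => by
      obtain ⟨n, hn⟩ := h X
      obtain ⟨P, h1, h2, h3⟩ := hn.exists_path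
      exact ⟨P, ⟨⟨n, h1.symm⟩, h2⟩, h3⟩)
  refine ⟨P, fun m n hmn => ?_, fun n => (hP n).1, fun n => (hP n).2,
    fun m n hmn => Set.disjoint_left.mpr (hd m n hmn)⟩
  by_contra hne
  exact hd m n hne _ (last_mem_vertexSet _) (hmn ▸ last_mem_vertexSet (P m))

/-- A finite set disjoint from infinitely many paths that are pairwise disjoint outside a set it
avoids misses one of them. -/
theorem exists_path_disjoint {P : ℕ → DiPath Adj} {C : Set V}
    (hd : ∀ m n, m ≠ n → ∀ x ∈ (P m).vertexSet, x ∈ (P n).vertexSet → x ∈ C)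
    (hX : ∀ x ∈ X, x ∉ C) : ∃ n, ∀ x ∈ (P n).vertexSet, x ∉ X := by
  by_contra! h
  choose g hg hgX using h
  refine not_injective_infinite_finite (fun n => (⟨g n, hgX n⟩ : X)) fun m n hmn => ?_
  by_contra hne
  have he : g m = g n := congrArg Subtype.val hmn
  exact hX _ (hgX m) (hd m n hne _ (hg m) (he ▸ hg n))

theorem reaches_of_goodV {Q : PR Adj} (hQ : Q.GoodV B) (hX : ∀ x ∈ Q.vertexSet, x ∉ X) :
    Reaches Adj B X Q.first := by
  match Q, hQ, hX with
  | .path P, .inl hB, hX => exact reaches_of_mem_path hB hX (first_mem_vertexSet P)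
  | .path P, .inr ⟨F, _, hF, hFB, hd⟩, hX =>
    have hlast := hX _ (last_mem_vertexSet P)
    obtain ⟨n, hn⟩ := exists_path_disjoint (C := {P.last}) hd
      (fun x hx h => hlast ((Set.mem_singleton_iff.mp h) ▸ hx))
    have hr := reaches_of_mem_path (hFB n) hn (first_mem_vertexSet _)
    rw [hF] at hr
    exact reaches_of_reaches_last hr hX (first_mem_vertexSet P)
  | .ray R, ⟨F, _, hF, hFB, hd⟩, hX =>
    obtain ⟨n, hn⟩ := exists_path_disjoint (C := ∅) (X := X)
      (fun m n hmn x hm hn => Set.disjoint_left.mp (hd m n hmn) hm hn) (fun _ _ h => h)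
    have hr := reaches_of_mem_path (hFB n) hn (first_mem_vertexSet _)
    obtain ⟨k, hk⟩ := hF n
    rw [← hk] at hr
    clear hk
    change Reaches Adj B X (R.f 0)
    induction k with
    | zero => exact hr
    | succ k ih => exact ih (hr.head (hX _ ⟨k, rfl⟩) (R.adj k))

/-- Only if part: a domination linkage yields linkages of all finite subsets. -/
theorem vFinLinked_of_vDomLinkage (h : VDomLinkage Adj A B) {S : Finset V} (hS : (S : Set V) ⊆ A) :
    VFinLinked Adj B S := by
  obtain ⟨Q, hQ, hgood, hd⟩ := h
  obtain ⟨U, f, hf⟩ := exists_isFlow (Adj := Adj) (B := B) S (fun X hX => by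
    by_contra! hno
    have hmeet : ∀ s : S, ∃ x ∈ (Q ⟨s, hS s.2⟩).vertexSet, x ∈ X := by
      intro s
      by_contra! hsX
      have := reaches_of_goodV (hgood _) hsX
      rw [hQ] at this
      exact hno s s.2 this
    choose g hg hgX using hmeet
    have hinj : Function.Injective fun s => (⟨g s, hgX s⟩ : X) := fun s t hst => by
      by_contra hne
      have he : g s = g t := congrArg Subtype.val hst
      exact Set.disjoint_left.mp (hd ⟨s, hS s.2⟩ ⟨t, hS t.2⟩
        fun h => hne (Subtype.ext (Subtype.mk.inj h))) (hg s) (he ▸ hg t)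
    have := Fintype.card_le_of_injective _ hinj
    simp only [Fintype.card_coe] at this
    omega)
  exact hf.vFinLinked

/-! ### Tight separators -/

/-- No finite `X` separates more than `#X` vertices of `A` from `B`. -/
def CutCondition (Adj : V → V → Prop) (B A : Set V) : Prop :=
  ∀ X S : Finset V, (S : Set V) ⊆ A ∩ Sep Adj B X → S.card ≤ X.card

/-- The finite set `X` separates exactly `#X` vertices of `A` from `B`. -/
def Tight (Adj : V → V → Prop) (B A : Set V) (X : Finset V) : Prop :=
  ∃ S : Finset V, (S : Set V) = A ∩ Sep Adj B X ∧ S.card = X.card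

theorem cutCondition_of_vFinLinked
    (h : ∀ S : Finset V, (S : Set V) ⊆ A → VFinLinked Adj B S) : CutCondition Adj B A := by
  intro X S hS
  obtain ⟨P, hP, hPB, hd⟩ := h S fun v hv => (hS hv).1
  have hmeet : ∀ s : S, ∃ x ∈ (P s).vertexSet, x ∈ X := by
    intro s
    by_contra! hsX
    have := reaches_of_mem_path (hPB s) hsX (first_mem_vertexSet _)
    rw [hP] at this
    exact (hS s.2).2 this
  choose g hg hgX using hmeet
  have hinj : Function.Injective fun s => (⟨g s, hgX s⟩ : X) := fun s t hst => by
    by_contra hne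
    have he : g s = g t := congrArg Subtype.val hst
    exact Set.disjoint_left.mp (hd s t hne) (hg s) (he ▸ hg t)
  simpa using Fintype.card_le_of_injective _ hinj

theorem exists_maximal_cutCondition (hA : CutCondition Adj B A) :
    ∃ A', A ⊆ A' ∧ Maximal (CutCondition Adj B) A' := by
  refine zorn_subset_nonempty {A | CutCondition Adj B A} (fun c hc hchain hne => ?_) A hA
  refine ⟨⋃₀ c, fun X S hS => ?_, fun s hs => Set.subset_sUnion_of_mem hs⟩
  obtain ⟨s, hs, hSs⟩ := hchain.directedOn.exists_mem_subset_of_finset_subset_biUnion hne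
    (f := id) (s := S) (fun v hv => by simpa using (hS hv).1)
  exact hc hs X S fun v hv => ⟨hSs hv, (hS hv).2⟩

namespace CutCondition

theorem tight_of_card_le (hA : CutCondition Adj B A) {S : Finset V}
    (hS : (S : Set V) ⊆ A ∩ Sep Adj B X) (h : X.card ≤ S.card) : Tight Adj B A X := by
  classical
  refine ⟨S, hS.antisymm fun v hv => ?_, (hA X S hS).antisymm h⟩
  by_contra hvS
  have h1 := hA X (insert v S) (by
    rw [Finset.coe_insert]
    exact Set.insert_subset hv hS)
  rw [Finset.card_insert_of_notMem hvS] at h1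
  omega

theorem tight_join_meet (hA : CutCondition Adj B A) (hX : Tight Adj B A X)
    (hY : Tight Adj B A Y) : Tight Adj B A (join Adj B X Y) ∧ Tight Adj B A (meet Adj B X Y) := by
  classical
  obtain ⟨S, hS, hSX⟩ := hX
  obtain ⟨T, hT, hTY⟩ := hY
  have h1 : ((S ∪ T : Finset V) : Set V) ⊆ A ∩ Sep Adj B (join Adj B X Y) := by
    rw [Finset.coe_union, hS, hT, ← Set.inter_union_distrib_left]
    exact Set.inter_subset_inter_right A sep_union_subset_join
  have h2 : ((S ∩ T : Finset V) : Set V) ⊆ A ∩ Sep Adj B (meet Adj B X Y) := by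
    rw [Finset.coe_inter, hS, hT, sep_meet, ← Set.inter_inter_distrib_left]
  have h3 := hA _ _ h1
  have h4 := hA _ _ h2
  have h5 := Finset.card_union_add_card_inter S T
  have h6 := @card_join_add_card_meet _ Adj B X Y
  exact ⟨hA.tight_of_card_le h1 (by omega), hA.tight_of_card_le h2 (by omega)⟩

theorem exists_tight_mem_sep (hA : Maximal (CutCondition Adj B) A) (v : V) :
    ∃ X, Tight Adj B A X ∧ v ∈ Sep Adj B X := by
  classical
  by_cases hv : v ∈ A
  · refine ⟨{v}, hA.prop.tight_of_card_le (S := {v}) ?_ le_rfl, subset_sep (by simp)⟩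
    rw [Finset.coe_singleton, Set.singleton_subset_iff]
    exact ⟨hv, subset_sep (by simp)⟩
  · by_contra! hno
    refine hv (hA.le_of_ge (y := insert v A) (fun X S hS => ?_) (Set.subset_insert v A)
      (Set.mem_insert v A))
    have hsub : ((S.erase v : Finset V) : Set V) ⊆ A ∩ Sep Adj B X := by
      intro w hw
      rw [Finset.mem_coe, Finset.mem_erase] at hw
      exact ⟨(hS hw.2).1.resolve_left hw.1, (hS hw.2).2⟩
    have hle := hA.prop X _ hsub
    by_cases hvS : v ∈ S
    · by_contra! hlt
      have := Finset.card_erase_add_one hvS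
      exact hno X (hA.prop.tight_of_card_le hsub (by omega)) (hS hvS).2
    · rwa [Finset.erase_eq_of_notMem hvS] at hle

end CutCondition

/-! ### Linkages to tight separators -/

/-- The successor function `f` on `U` describes a linkage of `A ∩ Sep X` to `X` within `Sep X`,
possibly together with some cycles. -/
structure IsLinkage (Adj : V → V → Prop) (B A : Set V) (X U : Finset V) (f : V → V) : Prop where
  inter_subset : A ∩ Sep Adj B X ⊆ U
  subset_sep : (U : Set V) ⊆ Sep Adj B X
  injOn : Set.InjOn f (U ∩ SepInt Adj B X)
  step : ∀ u ∈ U, u ∈ SepInt Adj B X → f u ∈ U ∧ f u ∉ A ∧ (f u = u ∨ Adj u (f u))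

theorem CutCondition.exists_isLinkage (hA : CutCondition Adj B A) (hX : Tight Adj B A X) :
    ∃ U f, IsLinkage Adj B A X U f := by
  classical
  obtain ⟨S, hS, hSX⟩ := hX
  obtain ⟨U, f, hSU, hinj, hstep⟩ := exists_isFlow (Adj := Adj) (B := B) S (fun Y hY => by
    by_contra! hno
    exact hY.not_ge (hA Y S fun s hs => ⟨(hS.subset hs).1, hno s hs⟩))
  have hXB : ∀ u, u ∈ SepInt Adj B X → u ∉ B := fun u hu => notMem_of_mem_sepInt hu
  refine ⟨U.filter (· ∈ Sep Adj B X), f, fun v hv => ?_, fun v hv => (Finset.mem_filter.mp hv).2,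
    hinj.mono (fun v hv => show _ ∧ _ from ⟨(Finset.mem_filter.mp hv.1).1, hXB v hv.2⟩),
    fun u hu hui => ?_⟩
  · exact Finset.mem_filter.mpr ⟨hSU (hS.superset hv), hv.2⟩
  · obtain ⟨h1, h2, h3⟩ := hstep u (Finset.mem_filter.mp hu).1 (hXB u hui)
    have hf : f u ∈ Sep Adj B X := by
      rcases h3 with h3 | h3
      · rw [h3]
        exact hui.1
      · exact mem_sep_of_adj hui h3
    exact ⟨Finset.mem_filter.mpr ⟨h1, hf⟩, fun h => h2 (hS.superset ⟨h, hf⟩), h3⟩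

namespace IsLinkage

variable {U U' : Finset V} {f f' : V → V}

theorem congr (h : IsLinkage Adj B A X U f) (hf : ∀ u ∈ U, u ∈ SepInt Adj B X → f u = f' u) :
    IsLinkage Adj B A X U f' where
  inter_subset := h.inter_subset
  subset_sep := h.subset_sep
  injOn := h.injOn.congr fun u hu => hf u hu.1 hu.2
  step u hu hui := hf u hu hui ▸ h.step u hu hui

theorem subset_and_exists_preimage (h : IsLinkage Adj B A X U f) (hX : Tight Adj B A X) :
    X ⊆ U ∧ ∀ w ∈ U, w ∉ A → ∃ u ∈ U, u ∈ SepInt Adj B X ∧ f u = w := by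
  classical
  obtain ⟨S, hS, hSX⟩ := hX
  have hSU : S ⊆ U := fun s hs => h.inter_subset (hS.subset hs)
  have hUX : U.filter (· ∈ SepInt Adj B X) = U \ X := by
    ext u
    rw [Finset.mem_filter, Finset.mem_sdiff]
    refine and_congr_right fun hu => ⟨fun hi : u ∈ SepInt Adj B X => hi.2, fun hi => ?_⟩
    exact ⟨h.subset_sep hu, hi⟩
  have himg : (U \ X).image f ⊆ U \ S := by
    rw [← hUX, Finset.image_subset_iff]
    intro u hu
    obtain ⟨h1, h2, -⟩ := h.step u (Finset.mem_filter.mp hu).1 (Finset.mem_filter.mp hu).2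
    exact Finset.mem_sdiff.mpr ⟨h1, fun hs => h2 (hS.subset hs).1⟩
  have hcard : ((U \ X).image f).card = (U \ X).card := by
    rw [← hUX]
    exact Finset.card_image_of_injOn fun u hu v hv =>
      h.injOn (by simpa using hu) (by simpa using hv)
  have h1 := Finset.card_le_card himg
  have h2 := Finset.card_sdiff_add_card_inter U X
  have h3 := Finset.card_sdiff_add_card_eq_card hSU
  have h4 := Finset.card_le_card (Finset.inter_subset_right : U ∩ X ⊆ X)
  have h5 : U ∩ X = X := Finset.eq_of_subset_of_card_le Finset.inter_subset_right (by omega)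
  refine ⟨Finset.inter_eq_right.mp h5, fun w hw hwA => ?_⟩
  have h6 := Finset.eq_of_subset_of_card_le himg (by omega)
  have hw' : w ∈ (U \ X).image f :=
    h6 ▸ Finset.mem_sdiff.mpr ⟨hw, fun hs => hwA (hS.subset hs).1⟩
  rw [← hUX] at hw'
  obtain ⟨u, hu, rfl⟩ := Finset.mem_image.mp hw'
  exact ⟨u, (Finset.mem_filter.mp hu).1, (Finset.mem_filter.mp hu).2, rfl⟩

open scoped Classical in
theorem restrict (h : IsLinkage Adj B A Y U f) (hS : Sep Adj B X ⊆ Sep Adj B Y)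
    (hI : SepInt Adj B X ⊆ SepInt Adj B Y) :
    IsLinkage Adj B A X (U.filter (· ∈ Sep Adj B X)) f where
  inter_subset v hv := Finset.mem_filter.mpr ⟨h.inter_subset ⟨hv.1, hS hv.2⟩, hv.2⟩
  subset_sep v hv := (Finset.mem_filter.mp hv).2
  injOn := h.injOn.mono fun v hv => show _ ∧ _ from ⟨(Finset.mem_filter.mp hv.1).1, hI hv.2⟩
  step u hu hui := by
    obtain ⟨h1, h2, h3⟩ := h.step u (Finset.mem_filter.mp hu).1 (hI hui)
    refine ⟨Finset.mem_filter.mpr ⟨h1, ?_⟩, h2, h3⟩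
    rcases h3 with h3 | h3
    · rw [h3]
      exact hui.1
    · exact mem_sep_of_adj hui h3

open scoped Classical in
/-- Replace the part of a linkage inside a smaller tight side by another linkage. -/
theorem substitute (h : IsLinkage Adj B A Y U f) (h' : IsLinkage Adj B A X U' f')
    (hX : Tight Adj B A X) (hS : Sep Adj B X ⊆ Sep Adj B Y)
    (hI : SepInt Adj B X ⊆ SepInt Adj B Y) :
    IsLinkage Adj B A Y (U.filter (· ∉ Sep Adj B X) ∪ U') ((SepInt Adj B X).piecewise f' f) := by
  obtain ⟨hXU, hpre⟩ := (h.restrict hS hI).subset_and_exists_preimage hX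
  obtain ⟨hXU', -⟩ := h'.subset_and_exists_preimage hX
  have hmem : ∀ u ∈ U.filter (· ∉ Sep Adj B X) ∪ U', u ∉ SepInt Adj B X → u ∈ U := by
    intro u hu hui
    rcases Finset.mem_union.mp hu with hu | hu
    · exact (Finset.mem_filter.mp hu).1
    · exact (Finset.mem_filter.mp (hXU ((mem_sep_iff.mp (h'.subset_sep hu)).resolve_left hui))).1
  have hmem' : ∀ u ∈ U.filter (· ∉ Sep Adj B X) ∪ U', u ∈ SepInt Adj B X → u ∈ U' := by
    intro u hu hui
    rcases Finset.mem_union.mp hu with hu | hu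
    · exact absurd hui.1 (Finset.mem_filter.mp hu).2
    · exact hu
  have hout : ∀ u ∈ U, u ∈ SepInt Adj B Y → u ∉ SepInt Adj B X → f u ∉ Sep Adj B X := by
    intro u hu huY huX hfu
    obtain ⟨h1, h2, -⟩ := h.step u hu huY
    obtain ⟨w, hw, hwX, hwu⟩ := hpre (f u) (Finset.mem_filter.mpr ⟨h1, hfu⟩) h2
    exact huX (h.injOn ⟨(Finset.mem_filter.mp hw).1, hI hwX⟩ ⟨hu, huY⟩ hwu ▸ hwX)
  refine ⟨?_, ?_, ?_, ?_⟩
  · intro v hv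
    by_cases hvX : v ∈ Sep Adj B X
    · exact Finset.mem_union_right _ (h'.inter_subset ⟨hv.1, hvX⟩)
    · exact Finset.mem_union_left _ (Finset.mem_filter.mpr ⟨h.inter_subset hv, hvX⟩)
  · intro v hv
    rcases Finset.mem_union.mp hv with hv | hv
    · exact h.subset_sep (Finset.mem_filter.mp hv).1
    · exact hS (h'.subset_sep hv)
  · rintro u ⟨hu, huY⟩ v ⟨hv, hvY⟩ huv
    by_cases huX : u ∈ SepInt Adj B X <;> by_cases hvX : v ∈ SepInt Adj B X
    · rw [Set.piecewise_eq_of_mem _ _ _ huX, Set.piecewise_eq_of_mem _ _ _ hvX] at huv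
      exact h'.injOn ⟨hmem' u hu huX, huX⟩ ⟨hmem' v hv hvX, hvX⟩ huv
    · rw [Set.piecewise_eq_of_mem _ _ _ huX, Set.piecewise_eq_of_notMem _ _ _ hvX] at huv
      exact absurd (huv ▸ h'.subset_sep (h'.step u (hmem' u hu huX) huX).1)
        (hout v (hmem v hv hvX) hvY hvX)
    · rw [Set.piecewise_eq_of_notMem _ _ _ huX, Set.piecewise_eq_of_mem _ _ _ hvX] at huv
      exact absurd (huv ▸ h'.subset_sep (h'.step v (hmem' v hv hvX) hvX).1)
        (hout u (hmem u hu huX) huY huX)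
    · rw [Set.piecewise_eq_of_notMem _ _ _ huX, Set.piecewise_eq_of_notMem _ _ _ hvX] at huv
      exact h.injOn ⟨hmem u hu huX, huY⟩ ⟨hmem v hv hvX, hvY⟩ huv
  · intro u hu huY
    by_cases huX : u ∈ SepInt Adj B X
    · rw [Set.piecewise_eq_of_mem _ _ _ huX]
      obtain ⟨h1, h2⟩ := h'.step u (hmem' u hu huX) huX
      exact ⟨Finset.mem_union_right _ h1, h2⟩
    · rw [Set.piecewise_eq_of_notMem _ _ _ huX]
      obtain ⟨h1, h2⟩ := h.step u (hmem u hu huX) huY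
      exact ⟨Finset.mem_union_left _ (Finset.mem_filter.mpr
        ⟨h1, hout u (hmem u hu huX) huY huX⟩), h2⟩

end IsLinkage

/-! ### Coherent linkages -/

/-- The least number of vertices of a linkage to `X`. -/
noncomputable def linkageSize (Adj : V → V → Prop) (B A : Set V) (X : Finset V) : ℕ :=
  sInf {n | ∃ U f, IsLinkage Adj B A X U f ∧ U.card = n}

theorem linkageSize_le {U : Finset V} {f : V → V} (h : IsLinkage Adj B A X U f) :
    linkageSize Adj B A X ≤ U.card :=
  Nat.sInf_le ⟨U, f, h, rfl⟩

namespace CutCondition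

theorem exists_isLinkage_card_eq (hA : CutCondition Adj B A) (hX : Tight Adj B A X) :
    ∃ U f, IsLinkage Adj B A X U f ∧ U.card = linkageSize Adj B A X := by
  obtain ⟨U, f, h⟩ := hA.exists_isLinkage hX
  exact Nat.sInf_mem (s := {n | ∃ U f, IsLinkage Adj B A X U f ∧ U.card = n}) ⟨_, U, f, h, rfl⟩

theorem linkageSize_mono (hA : CutCondition Adj B A) (hX : Tight Adj B A X)
    (hY : Tight Adj B A Y) (hS : Sep Adj B X ⊆ Sep Adj B Y)
    (hI : SepInt Adj B X ⊆ SepInt Adj B Y) :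
    linkageSize Adj B A X ≤ linkageSize Adj B A Y ∧
      (linkageSize Adj B A X = linkageSize Adj B A Y → X = Y) := by
  classical
  obtain ⟨U, f, h, hU⟩ := hA.exists_isLinkage_card_eq hY
  have hle := linkageSize_le (h.restrict hS hI)
  have hle' := Finset.card_filter_le U (· ∈ Sep Adj B X)
  refine ⟨by omega, fun heq => ?_⟩
  have hUX : U.filter (· ∈ Sep Adj B X) = U :=
    Finset.eq_of_subset_of_card_le (Finset.filter_subset _ _) (by omega)
  have hYX : Y ⊆ X := by
    intro y hy
    have hyU := (h.subset_and_exists_preimage hY).1 hy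
    rw [← hUX] at hyU
    exact (mem_sep_iff.mp (Finset.mem_filter.mp hyU).2).resolve_left fun hi => (hI hi).2 hy
  obtain ⟨S, hS', hSX⟩ := hX
  obtain ⟨T, hT, hTY⟩ := hY
  have hST : S.card ≤ T.card := Finset.card_le_card fun s hs => by
    have : s ∈ A ∩ Sep Adj B X := hS'.subset hs
    exact hT.superset ⟨this.1, hS this.2⟩
  exact (Finset.eq_of_subset_of_card_le hYX (by omega)).symm

/-- For each vertex inside some tight side there is a least tight separator having it inside. -/
theorem exists_least_tight (hA : CutCondition Adj B A)
    (hv : ∃ X, Tight Adj B A X ∧ v ∈ SepInt Adj B X) :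
    ∃ X, Tight Adj B A X ∧ v ∈ SepInt Adj B X ∧ ∀ Y, Tight Adj B A Y → v ∈ SepInt Adj B Y →
      Sep Adj B X ⊆ Sep Adj B Y ∧ SepInt Adj B X ⊆ SepInt Adj B Y := by
  obtain ⟨X, ⟨hX, hvX⟩, hmin⟩ := exists_minimalFor_of_wellFoundedLT
    (fun X => Tight Adj B A X ∧ v ∈ SepInt Adj B X) (linkageSize Adj B A) hv
  refine ⟨X, hX, hvX, fun Y hY hvY => ?_⟩
  have hM := (hA.tight_join_meet hX hY).2
  have hS := sep_meet (Adj := Adj) (B := B) (X := X) (Y := Y)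
  have hI := sepInt_meet (Adj := Adj) (B := B) (X := X) (Y := Y)
  obtain ⟨h1, h2⟩ := hA.linkageSize_mono hM hX (hS ▸ Set.inter_subset_left)
    (hI ▸ Set.inter_subset_left)
  have heq := h2 (h1.antisymm (hmin ⟨hM, hI ▸ ⟨hvX, hvY⟩⟩ h1))
  rw [heq] at hS hI
  exact ⟨Set.inter_eq_left.mp hS.symm, Set.inter_eq_left.mp hI.symm⟩

/-- A single successor function describes linkages to all tight separators. -/
theorem exists_next (hA : CutCondition Adj B A) :
    ∃ next : V → V, ∀ Y, Tight Adj B A Y → ∃ U, IsLinkage Adj B A Y U next := by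
  classical
  have hΛ : ∀ X, ∃ U f, Tight Adj B A X → IsLinkage Adj B A X U f := fun X => by
    by_cases hX : Tight Adj B A X
    · obtain ⟨U, f, h⟩ := hA.exists_isLinkage hX
      exact ⟨U, f, fun _ => h⟩
    · exact ⟨∅, id, fun h => absurd h hX⟩
  choose UΛ fΛ hΛ using hΛ
  have hm : ∀ v, ∃ X, (∃ X, Tight Adj B A X ∧ v ∈ SepInt Adj B X) →
      Tight Adj B A X ∧ v ∈ SepInt Adj B X ∧ ∀ Y, Tight Adj B A Y → v ∈ SepInt Adj B Y →
        Sep Adj B X ⊆ Sep Adj B Y ∧ SepInt Adj B X ⊆ SepInt Adj B Y := fun v => by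
    by_cases hv : ∃ X, Tight Adj B A X ∧ v ∈ SepInt Adj B X
    · obtain ⟨X, hX⟩ := hA.exists_least_tight hv
      exact ⟨X, fun _ => hX⟩
    · exact ⟨∅, fun h => absurd h hv⟩
  choose m hm using hm
  refine ⟨fun v => fΛ (m v) v, fun Y => ?_⟩
  set next : V → V := fun v => fΛ (m v) v
  induction hn : linkageSize Adj B A Y using Nat.strong_induction_on generalizing Y with
  | _ n ih =>
  intro hY
  subst hn
  let bad : Finset V × (V → V) → Finset V := fun L =>
    L.1.filter fun u => u ∈ SepInt Adj B Y ∧ L.2 u ≠ next u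
  obtain ⟨⟨U, f⟩, ⟨hL, hgood⟩, hmin⟩ := exists_minimalFor_of_wellFoundedLT
    (fun L : Finset V × (V → V) => IsLinkage Adj B A Y L.1 L.2 ∧
      ∀ u ∈ SepInt Adj B Y, m u = Y → L.2 u = next u) (fun L => (bad L).card)
    ⟨(UΛ Y, fΛ Y), hΛ Y hY, fun u _ hu => by simp only [next, hu]⟩
  dsimp only at hL hgood
  by_cases hbad : bad (U, f) = ∅
  · refine ⟨U, hL.congr fun u hu huY => ?_⟩
    by_contra hne
    have : u ∈ bad (U, f) := Finset.mem_filter.mpr ⟨hu, huY, hne⟩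
    simp [hbad] at this
  exfalso
  obtain ⟨v, hv⟩ := Finset.nonempty_iff_ne_empty.mpr hbad
  obtain ⟨hvU, hvY, hvn⟩ := Finset.mem_filter.mp hv
  obtain ⟨hX, hvX, hle⟩ := hm v ⟨Y, hY, hvY⟩
  obtain ⟨hS, hI⟩ := hle Y hY hvY
  have hne : m v ≠ Y := fun h => hvn (hgood v hvY h)
  obtain ⟨h1, h2⟩ := hA.linkageSize_mono hX hY hS hI
  obtain ⟨U', hU'⟩ := ih _ (h1.lt_of_ne fun h => hne (h2 h)) (m v) rfl hX
  have hsub := hL.substitute hU' hX hS hI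
  have hlt : (bad (U.filter (· ∉ Sep Adj B (m v)) ∪ U',
      (SepInt Adj B (m v)).piecewise next f)).card < (bad (U, f)).card := by
    refine Finset.card_lt_card (Finset.ssubset_iff_of_subset ?_ |>.mpr ⟨v, hv, ?_⟩)
    · intro u hu
      obtain ⟨huU, huY, hun⟩ := Finset.mem_filter.mp hu
      dsimp only at huU hun
      have huX : u ∉ SepInt Adj B (m v) := fun h => hun (Set.piecewise_eq_of_mem _ _ _ h)
      rw [Set.piecewise_eq_of_notMem _ _ _ huX] at hun
      refine Finset.mem_filter.mpr ⟨?_, huY, hun⟩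
      rcases Finset.mem_union.mp huU with h | h
      · exact (Finset.mem_filter.mp h).1
      · exact (Finset.mem_filter.mp (((hL.restrict hS hI).subset_and_exists_preimage hX).1
          ((mem_sep_iff.mp (hU'.subset_sep h)).resolve_left huX))).1
    · exact fun h => (Finset.mem_filter.mp h).2.2 (Set.piecewise_eq_of_mem _ _ _ hvX)
  refine hlt.not_ge (hmin ⟨hsub, fun u huY hu => ?_⟩ hlt.le)
  by_cases huX : u ∈ SepInt Adj B (m v)
  · exact Set.piecewise_eq_of_mem _ _ _ huX
  · exact (Set.piecewise_eq_of_notMem _ _ _ huX).trans (hgood u huY hu)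

/-- Finitely many vertices inside tight sides lie inside a common one. -/
theorem exists_tight_of_finite (hA : CutCondition Adj B A) (hX : Tight Adj B A X) {s : Set V}
    (hs : s.Finite) (h : ∀ v ∈ s, ∃ Y, Tight Adj B A Y ∧ v ∈ SepInt Adj B Y) :
    ∃ Z, Tight Adj B A Z ∧ Sep Adj B X ⊆ Sep Adj B Z ∧ SepInt Adj B X ⊆ SepInt Adj B Z ∧
      s ⊆ SepInt Adj B Z := by
  induction s, hs using Set.Finite.induction_on with
  | empty => exact ⟨X, hX, subset_rfl, subset_rfl, Set.empty_subset _⟩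
  | @insert v s _ _ ih =>
    obtain ⟨Z, hZ, h1, h2, h3⟩ := ih fun w hw => h w (Set.mem_insert_of_mem v hw)
    obtain ⟨Y, hY, hvY⟩ := h v (Set.mem_insert v s)
    obtain ⟨-, hS⟩ := Set.union_subset_iff.mp
      (sep_union_subset_join (Adj := Adj) (B := B) (X := Y) (Y := Z))
    obtain ⟨hYI, hZI⟩ := Set.union_subset_iff.mp
      (sepInt_union_subset_join (Adj := Adj) (B := B) (X := Y) (Y := Z))
    exact ⟨join Adj B Y Z, (hA.tight_join_meet hY hZ).1, h1.trans hS, h2.trans hZI,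
      Set.insert_subset (hYI hvY) (h3.trans hZI)⟩

theorem exists_tight_superset (hA : Maximal (CutCondition Adj B) A) (W : Finset V) :
    ∃ Z, Tight Adj B A Z ∧ (W : Set V) ⊆ Sep Adj B Z := by
  classical
  induction W using Finset.induction_on with
  | empty =>
    exact ⟨∅, hA.prop.tight_of_card_le (S := ∅) (by simp) le_rfl, by simp⟩
  | insert v W _ ih =>
    obtain ⟨Z, hZ, hWZ⟩ := ih
    obtain ⟨Y, hY, hvY⟩ := exists_tight_mem_sep hA v
    obtain ⟨h1, h2⟩ := Set.union_subset_iff.mp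
      (sep_union_subset_join (Adj := Adj) (B := B) (X := Y) (Y := Z))
    refine ⟨join Adj B Y Z, (hA.prop.tight_join_meet hY hZ).1, ?_⟩
    rw [Finset.coe_insert]
    exact Set.insert_subset (h1 hvY) (hWZ.trans h2)

/-- A vertex that is not inside any tight side lies in `B` or dominates `B`. -/
theorem mem_or_vDomSet (hA : Maximal (CutCondition Adj B) A)
    (hv : ¬ ∃ X, Tight Adj B A X ∧ v ∈ SepInt Adj B X) : v ∈ B ∨ VDomSet Adj B v := by
  classical
  by_contra! hno
  refine hno.2 (vDomSet_of_reaches hno.1 fun W hvW => ?_)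
  by_contra hvr
  obtain ⟨Y, hY, hWY⟩ := exists_tight_superset hA W
  have hWY' := sep_mono hWY
  have hvY : v ∈ Y := (mem_sep_iff.mp (hWY' hvr)).resolve_left fun h => hv ⟨Y, hY, h⟩
  have hE : insert v (SepInt Adj B Y) ⊆ Sep Adj B (Y.erase v) := by
    refine subset_sep_of_closed ?_ fun u hu w huw => ?_
    · rintro u (rfl | hu)
      · exact hno.1
      · exact notMem_of_mem_sepInt hu
    · have hw : w ∈ Sep Adj B Y := by
        rcases hu with rfl | hu
        · exact hWY' (mem_sep_of_adj ⟨hvr, hvW⟩ huw)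
        · exact mem_sep_of_adj hu huw
      have := mem_sep_iff.mp hw
      rw [Set.mem_insert_iff, Finset.mem_erase]
      tauto
  have hsep : Sep Adj B Y ⊆ Sep Adj B (Y.erase v) := by
    refine sep_mono fun y hy => ?_
    by_cases hyv : y = v
    · rw [hyv]
      exact hE (Set.mem_insert v _)
    · exact subset_sep (Finset.mem_erase.mpr ⟨hyv, hy⟩)
  obtain ⟨S, hS, hSY⟩ := hY
  have h1 := hA.prop (Y.erase v) S (hS.subset.trans (Set.inter_subset_inter_right A hsep))
  have := Finset.card_erase_lt_of_mem hvY
  omega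

/-- If part for a maximal set of sources. -/
theorem vDomLinkage (hA : Maximal (CutCondition Adj B) A) : VDomLinkage Adj A B := by
  classical
  obtain ⟨next, hnext⟩ := hA.prop.exists_next
  let I : V → Prop := fun v => ∃ X, Tight Adj B A X ∧ v ∈ SepInt Adj B X
  let o : V → ℕ → V := fun a n => next^[n] a
  have ho : ∀ a n, o a (n + 1) = next (o a n) := fun a n =>
    Function.iterate_succ_apply' next n a
  have horbit : ∀ {Z U : Finset V}, IsLinkage Adj B A Z U next → ∀ a ∈ A, a ∈ Sep Adj B Z →
      ∀ n, (∀ k < n, o a k ∈ SepInt Adj B Z) → o a n ∈ U := by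
    intro Z U hZ a ha haZ n
    induction n with
    | zero => exact fun _ => hZ.inter_subset ⟨ha, haZ⟩
    | succ n ih =>
      intro hn
      rw [ho]
      exact (hZ.step _ (ih fun k hk => hn k (by omega)) (hn n (by omega))).1
  have hcover : ∀ a i, (∀ k < i, I (o a k)) → ∀ a' j, (∀ k < j, I (o a' k)) →
      ∃ Z, Tight Adj B A Z ∧ a ∈ Sep Adj B Z ∧ a' ∈ Sep Adj B Z ∧
        (∀ k < i, o a k ∈ SepInt Adj B Z) ∧ ∀ k < j, o a' k ∈ SepInt Adj B Z := by
    intro a i hi a' j hj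
    obtain ⟨X, hX, haX⟩ := exists_tight_superset hA {a, a'}
    obtain ⟨Z, hZ, hXZ, -, hsZ⟩ := hA.prop.exists_tight_of_finite hX
      (s := o a '' Set.Iio i ∪ o a' '' Set.Iio j)
      (((Set.finite_Iio i).image _).union ((Set.finite_Iio j).image _)) (by
        rintro - (⟨k, hk, rfl⟩ | ⟨k, hk, rfl⟩)
        · exact hi k hk
        · exact hj k hk)
    exact ⟨Z, hZ, hXZ (haX (by simp)), hXZ (haX (by simp)),
      fun k hk => hsZ (Or.inl ⟨k, hk, rfl⟩), fun k hk => hsZ (Or.inr ⟨k, hk, rfl⟩)⟩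
  have key : ∀ a ∈ A, ∀ a' ∈ A, ∀ i j, (∀ k < i, I (o a k)) → (∀ k < j, I (o a' k)) →
      o a i = o a' j → i = j ∧ a = a' := by
    intro a ha a' ha' i j hi hj
    obtain ⟨Z, hZ, haZ, haZ', hiZ, hjZ⟩ := hcover a i hi a' j hj
    obtain ⟨U, hU⟩ := hnext Z hZ
    exact orbit_injective hU.injOn (fun v hv => (hU.step v hv.1 hv.2).2.1) ha ha'
      (fun k hk => ⟨horbit hU a ha haZ k fun l hl => hiZ l (hl.trans hk), hiZ k hk⟩)
      (fun k hk => ⟨horbit hU a' ha' haZ' k fun l hl => hjZ l (hl.trans hk), hjZ k hk⟩)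
  have hadj : ∀ a ∈ A, ∀ i, (∀ k ≤ i, I (o a k)) → Adj (o a i) (o a (i + 1)) := by
    intro a ha i hi
    obtain ⟨Z, hZ, haZ, -, hiZ, -⟩ := hcover a (i + 1) (fun k hk => hi k (by omega)) a 0 (by simp)
    obtain ⟨U, hU⟩ := hnext Z hZ
    have h := (hU.step _ (horbit hU a ha haZ i fun k hk => hiZ k (by omega))
      (hiZ i (by omega))).2.2
    rw [← ho] at h
    refine h.resolve_left fun he => ?_
    have := (key a ha a ha (i + 1) i (fun k hk => hi k (by omega)) (fun k hk => hi k hk.le) he).1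
    omega
  have hQ : ∀ a : A, ∃ Q : PR Adj, Q.first = a ∧ Q.GoodV B ∧
      ∀ v ∈ Q.vertexSet, ∃ i, (∀ k < i, I (o a k)) ∧ o a i = v := by
    rintro ⟨a, ha⟩
    by_cases hex : ∃ n, ¬ I (o a n)
    · have hlt : ∀ i ≤ Nat.find hex, ∀ k < i, I (o a k) := fun i hi k hk =>
        not_not.mp (Nat.find_min hex (hk.trans_le hi))
      refine ⟨.path (pathOfSeq (o a) (Nat.find hex)
        (fun i hi => hadj a ha i fun k hk => hlt _ le_rfl k (by omega))
        (fun i hi j hj he => (key a ha a ha i j (hlt i hi) (hlt j hj) he).1)), ?_, ?_, ?_⟩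
      · exact pathOfSeq_first
      · change _ ∈ B ∨ VDomSet Adj B _
        rw [pathOfSeq_last]
        exact mem_or_vDomSet hA (Nat.find_spec hex)
      · intro v hv
        obtain ⟨i, hi, rfl⟩ := mem_vertexSet_pathOfSeq.mp hv
        exact ⟨i, hlt i hi, rfl⟩
    · push Not at hex
      have hinj : Function.Injective (o a) := fun i j he =>
        (key a ha a ha i j (fun k _ => hex k) (fun k _ => hex k) he).1
      refine ⟨.ray ⟨o a, hinj, fun i => hadj a ha i fun k _ => hex k⟩, rfl, ?_, ?_⟩
      · refine rDomSet_of_reaches fun W => ?_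
        by_contra! hW
        obtain ⟨Y, hY, hWY⟩ := exists_tight_superset hA W
        have hRY : ∀ n, o a n ∈ Sep Adj B Y := fun n => sep_mono hWY (hW n)
        obtain ⟨Z, hZ, hYZ, hYZ', hsZ⟩ := hA.prop.exists_tight_of_finite hY
          (Y.finite_toSet.inter_of_left (Set.range (o a))) (by
            rintro - ⟨-, n, rfl⟩
            exact hex n)
        have hRZ : ∀ n, o a n ∈ SepInt Adj B Z := fun n =>
          (mem_sep_iff.mp (hRY n)).elim (fun h => hYZ' h) fun h => hsZ ⟨h, n, rfl⟩
        obtain ⟨U, hU⟩ := hnext Z hZ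
        exact Set.infinite_range_of_injective hinj (U.finite_toSet.subset
          (Set.range_subset_iff.mpr fun n =>
            horbit hU a ha (hRZ 0).1 n fun k _ => hRZ k))
      · rintro v ⟨i, rfl⟩
        exact ⟨i, fun k _ => hex k, rfl⟩
  choose Q hQ1 hQ2 hQ3 using hQ
  refine ⟨Q, hQ1, hQ2, fun a a' hne => Set.disjoint_left.mpr fun v hv hv' => ?_⟩
  obtain ⟨i, hi, hiv⟩ := hQ3 a v hv
  obtain ⟨j, hj, hjv⟩ := hQ3 a' v hv'
  exact hne (Subtype.ext (key a a.2 a' a'.2 i j hi hj (hiv.trans hjv.symm)).2)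

end CutCondition

theorem vDomLinkage_mono {A' : Set V} (hAA' : A ⊆ A') (h : VDomLinkage Adj A' B) :
    VDomLinkage Adj A B := by
  obtain ⟨Q, hQ, hgood, hd⟩ := h
  refine ⟨fun a => Q ⟨a, hAA' a.2⟩, fun a => hQ _, fun a => hgood _, fun a a' hne => hd _ _ ?_⟩
  exact fun h => hne (Subtype.ext (Subtype.mk.inj h))

end DomLinkage

theorem stmt15 {V : Type*} [Infinite V] (Adj : V → V → Prop) (A B : Set V) :
    VDomLinkage Adj A B ↔ ∀ S : Finset V, ↑S ⊆ A → VFinLinked Adj B S := by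
  refine ⟨fun h S hS => DomLinkage.vFinLinked_of_vDomLinkage h hS, fun h => ?_⟩
  obtain ⟨A', hAA', hA'⟩ := DomLinkage.exists_maximal_cutCondition
    (DomLinkage.cutCondition_of_vFinLinked h)
  exact DomLinkage.vDomLinkage_mono hAA' (DomLinkage.CutCondition.vDomLinkage hA')
end

section
/- Let G be a digraph and B ⊆ V(G). Define 𝓛_T(G,B) to be the collection of vertex sets I such that there is a family of pairwise vertex-disjoint directed paths or rays (Q_v | v ∈ I), each Q_v starting at v and either ending in B or dominating B. Then 𝓛_T(G,B) equals the finitarization of 𝓛(G,B): I ∈ 𝓛_T(G,B) if and only if every finite subset of I is in 𝓛(G,B). Moreover 𝓛_T(G,B) is the set of independent sets of a finitary matroid. -/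
section
open Set

/-- Removing a set and removing its image under a finitely supported injection leaves
equally many elements. -/
lemma encard_diff_image_of_finite_support {V : Type*} {m : V → V} {L F : Set V} (hLF : L ⊆ F)
    (hm : MapsTo m L F) (hinj : InjOn m L) (hfin : {x | x ∈ L ∧ m x ≠ x}.Finite) :
    (F \ m '' L).encard = (F \ L).encard := by
  set D : Set V := {x | x ∈ L ∧ m x ≠ x} with hD
  have hDL : D ⊆ L := fun x hx => hx.1
  have hfix : ∀ x ∈ L, x ∉ D → m x = x := fun x hx hxD => by
    by_contra h
    exact hxD ⟨hx, h⟩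
  have hDF : D ⊆ F \ (L \ D) := fun x hx => ⟨hLF hx.1, fun h => h.2 hx⟩
  have hmDF : m '' D ⊆ F \ (L \ D) := by
    rintro _ ⟨x, hx, rfl⟩
    refine ⟨hm hx.1, fun h => h.2 ?_⟩
    rwa [hinj h.1 hx.1 (hfix _ h.1 h.2)]
  have h1 : F \ L = (F \ (L \ D)) \ D := by
    ext x
    simp only [mem_sdiff]
    constructor
    · rintro ⟨hx, hxL⟩
      exact ⟨⟨hx, fun h => hxL h.1⟩, fun h => hxL (hDL h)⟩
    · rintro ⟨⟨hx, h⟩, hxD⟩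
      exact ⟨hx, fun hxL => h ⟨hxL, hxD⟩⟩
  have h2 : F \ m '' L = (F \ (L \ D)) \ (m '' D) := by
    ext x
    simp only [mem_sdiff, mem_image, not_exists, not_and]
    constructor
    · rintro ⟨hx, hxL⟩
      exact ⟨⟨hx, fun h hxD => hxL x h (hfix x h hxD)⟩, fun y hy => hxL y (hDL hy)⟩
    · rintro ⟨⟨hx, h⟩, hxD⟩
      refine ⟨hx, fun y hy hyx => ?_⟩
      by_cases hyD : y ∈ D
      · exact hxD y hyD hyx
      · have := hfix y hy hyD
        exact hyD (by_contra fun h' => (h (by rwa [← hyx, this])) (by rwa [← hyx, this]))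
  have e1 := encard_sdiff_add_encard_of_subset hDF
  have e2 := encard_sdiff_add_encard_of_subset hmDF
  rw [(hinj.mono hDL).encard_image, ← e1] at e2
  rw [h1, h2]
  exact (ENat.add_left_injective_of_ne_top hfin.encard_lt_top.ne) e2

section
variable {V : Type*} {Adj : V → V → Prop} {B : Set V}

/-- `m` matches every vertex outside `B` injectively with itself or an out-neighbour. -/
structure StepMap (Adj : V → V → Prop) (B : Set V) (m : V → V) : Prop where
  injOn : InjOn m Bᶜ
  step : ∀ x, x ∉ B → m x = x ∨ Adj x (m x)

/-- `S` is avoided by some step map moving only finitely many vertices. For finite `S` this means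
that `S` is linked to `B`. -/
def Avoidable (Adj : V → V → Prop) (B S : Set V) : Prop :=
  ∃ m, StepMap Adj B m ∧ {x | x ∉ B ∧ m x ≠ x}.Finite ∧ ∀ x, x ∉ B → m x ∉ S

/-- `X` separates `Z` from `B`: some `L` disjoint from `B` is left only through `X`, and
`Z` lies in `X ∪ L`. -/
def Separates (Adj : V → V → Prop) (B X Z : Set V) : Prop :=
  ∃ L : Set V, (∀ x ∈ L, x ∉ B) ∧ Z ⊆ X ∪ L ∧ ∀ x ∈ L, ∀ y, Adj x y → y ∈ X ∪ L

lemma Avoidable.mono {S T : Set V} (hT : Avoidable Adj B T) (h : S ⊆ T) : Avoidable Adj B S := by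
  obtain ⟨m, h1, h2, h3⟩ := hT
  exact ⟨m, h1, h2, fun x hx hS => h3 x hx (h hS)⟩

lemma avoidable_empty : Avoidable Adj B ∅ :=
  ⟨id, ⟨fun _ _ _ _ h => h, fun _ _ => Or.inl rfl⟩, by simp, by simp⟩

lemma Separates.encard_le {X Z T : Set V} (hX : Separates Adj B X Z) (hT : Avoidable Adj B T)
    (hTZ : T ⊆ Z) : T.encard ≤ X.encard := by
  obtain ⟨L, hLB, hZ, hL⟩ := hX
  obtain ⟨m, hm, hfin, hmT⟩ := hT
  have key := encard_diff_image_of_finite_support (m := m) (L := L) (F := X ∪ L)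
    subset_union_right
    (fun x hx => by
      rcases hm.step x (hLB x hx) with h | h
      · exact Or.inr (by rwa [h])
      · exact hL x hx _ h)
    (hm.injOn.mono hLB) (hfin.subset fun x hx => ⟨hLB x hx.1, hx.2⟩)
  calc T.encard ≤ ((X ∪ L) \ m '' L).encard := by
        refine encard_le_encard fun t ht => ⟨hZ (hTZ ht), ?_⟩
        rintro ⟨x, hx, rfl⟩
        exact hmT x (hLB x hx) ht
    _ = ((X ∪ L) \ L).encard := key
    _ ≤ X.encard := by
        refine encard_le_encard fun t ht => ?_
        exact ht.1.resolve_right ht.2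

/-- Vertices outside `S` from which an alternating chain of length `n` leads to a vertex
unmatched by `m`. -/
def altLevel (Adj : V → V → Prop) (B S : Set V) (m : V → V) : ℕ → Set V
  | 0 => {y | y ∉ S ∧ ∀ x, x ∉ B → m x ≠ y}
  | n + 1 => {c | ∃ x, x ∉ B ∧ m x = c ∧ ∃ y ∈ altLevel Adj B S m n, y = x ∨ Adj x y}

open Classical in
lemma exists_stepMap_of_mem_altLevel {S : Set V} {m : V → V} (hm : StepMap Adj B m)
    (hfin : {x | x ∉ B ∧ m x ≠ x}.Finite) (hS : ∀ x, x ∉ B → m x ∉ S) (n : ℕ) :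
    ∀ c ∈ altLevel Adj B S m n, (∀ j < n, c ∉ altLevel Adj B S m j) →
      ∃ m', StepMap Adj B m' ∧ {x | x ∉ B ∧ m' x ≠ x}.Finite ∧
        (∀ x, x ∉ B → m' x ∉ insert c S) ∧
        ∀ x, x ∉ B → (∀ j ≤ n, m x ∉ altLevel Adj B S m j) → m' x = m x := by
  induction n with
  | zero =>
    intro c hc _
    refine ⟨m, hm, hfin, fun x hx h => ?_, fun _ _ _ => rfl⟩
    rcases h with h | h
    · exact hc.2 x hx h
    · exact hS x hx h
  | succ n ih =>
    rintro c ⟨x, hxB, hxc, y, hy, hxy⟩ hmin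
    obtain ⟨m', hm', hfin', hS', hagree⟩ := ih y hy fun j hj hyj =>
      hmin (j + 1) (by omega) ⟨x, hxB, hxc, y, hyj, hxy⟩
    have hx' : m' x = c := by
      rw [hagree x hxB fun j hj => by rw [hxc]; exact hmin j (by omega), hxc]
    have hyS : y ∉ S := by
      cases n with
      | zero => exact hy.1
      | succ n =>
        obtain ⟨z, hz, rfl, _⟩ := hy
        exact hS z hz
    have hne : ∀ z, z ∉ B → m' z ≠ y := fun z hz h => hS' z hz (Or.inl h)
    refine ⟨Function.update m' x y, ⟨?_, ?_⟩, ?_, ?_, ?_⟩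
    · intro a ha b hb hab
      by_cases hax : a = x <;> by_cases hbx : b = x
      · rw [hax, hbx]
      · subst hax
        rw [Function.update_self, Function.update_of_ne hbx] at hab
        exact absurd hab.symm (hne b hb)
      · subst hbx
        rw [Function.update_self, Function.update_of_ne hax] at hab
        exact absurd hab (hne a ha)
      · rw [Function.update_of_ne hax, Function.update_of_ne hbx] at hab
        exact hm'.injOn ha hb hab
    · intro a ha
      by_cases hax : a = x
      · subst hax
        rw [Function.update_self]
        exact hxy
      · rw [Function.update_of_ne hax]
        exact hm'.step a ha
    · refine (hfin'.insert x).subset fun a ha => ?_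
      by_cases hax : a = x
      · exact Or.inl hax
      · refine Or.inr ⟨ha.1, ?_⟩
        have := ha.2
        rwa [Function.update_of_ne hax] at this
    · intro a ha h
      by_cases hax : a = x
      · subst hax
        rw [Function.update_self] at h
        rcases h with h | h
        · exact hne a ha (by rw [h]; exact hx')
        · exact hyS h
      · rw [Function.update_of_ne hax] at h
        rcases h with h | h
        · exact hax (hm'.injOn ha hxB (by rw [h, hx']))
        · exact hS' a ha (Or.inr h)
    · intro a ha h
      have hax : a ≠ x := by
        rintro rfl
        exact h (n + 1) le_rfl ⟨a, ha, rfl, y, hy, hxy⟩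
      rw [Function.update_of_ne hax]
      exact hagree a ha fun j hj => h j (by omega)

/-- Menger's theorem: a maximal linkable subset `S` of `Z` comes with a separator of size `|S|`. -/
lemma Avoidable.exists_separates {S Z : Set V} (hS : Avoidable Adj B S)
    (hmax : ∀ z ∈ Z, z ∉ S → ¬ Avoidable Adj B (insert z S)) :
    ∃ X, X.encard = S.encard ∧ Separates Adj B X Z := by
  classical
  obtain ⟨m, hm, hfin, hmS⟩ := hS
  set A : Set V := ⋃ n, altLevel Adj B S m n with hA
  have hA' : ∀ {x}, x ∈ A ↔ ∃ n, x ∈ altLevel Adj B S m n := by simp [hA]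
  have hZA : ∀ z ∈ Z, z ∉ S → z ∉ A := by
    intro z hz hzS hzA
    rw [hA'] at hzA
    obtain ⟨m', h1, h2, h3, _⟩ := exists_stepMap_of_mem_altLevel hm hfin hmS (Nat.find hzA) z
      (Nat.find_spec hzA) fun j hj => Nat.find_min hzA hj
    exact hmax z hz hzS ⟨m', h1, h2, h3⟩
  set L : Set V := {x | x ∉ B ∧ m x ∉ A} with hL
  have hcover : ∀ y, y ∉ A → y ∈ S ∪ m '' L := by
    intro y hy
    by_contra h
    rw [mem_union, not_or] at h
    refine hy (hA'.2 ⟨0, h.1, fun x hx hxy => h.2 ⟨x, ⟨hx, by rwa [hxy]⟩, hxy⟩⟩)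
  have hnbr : ∀ x ∈ L, ∀ y, y = x ∨ Adj x y → y ∈ S ∪ m '' L := by
    intro x hx y hxy
    refine hcover y fun hy => hx.2 ?_
    obtain ⟨n, hn⟩ := hA'.1 hy
    exact hA'.2 ⟨n + 1, x, hx.1, rfl, y, hn, hxy⟩
  have hLF : L ⊆ S ∪ m '' L := fun x hx => hnbr x hx x (Or.inl rfl)
  have hunion : (S ∪ m '' L) \ L ∪ L = S ∪ m '' L := sdiff_union_of_subset hLF
  refine ⟨(S ∪ m '' L) \ L, ?_, L, fun x hx => hx.1, ?_, ?_⟩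
  · rw [← encard_diff_image_of_finite_support (m := m) hLF
      (fun x hx => Or.inr (mem_image_of_mem m hx)) (hm.injOn.mono fun x hx => hx.1)
      (hfin.subset fun x hx => ⟨hx.1.1, hx.2⟩)]
    congr 1
    ext y
    constructor
    · rintro ⟨h1, h2⟩
      exact h1.resolve_right h2
    · intro hy
      refine ⟨Or.inl hy, ?_⟩
      rintro ⟨x, hx, rfl⟩
      exact hmS x hx.1 hy
  · rw [hunion]
    intro z hz
    by_cases hzS : z ∈ S
    · exact Or.inl hzS
    · exact hcover z (hZA z hz hzS)
  · rw [hunion]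
    exact fun x hx y hxy => hnbr x hx y (Or.inr hxy)

end
end

section
open Set
variable {V : Type*} {Adj : V → V → Prop} {B : Set V}

/-- A set linked to `B` by finitely many disjoint paths is avoided by the step map which advances
along the paths. -/
lemma avoidable_of_mem_LGB {S : Set V} (hSfin : S.Finite) (hS : S ∈ LGB Adj B) :
    Avoidable Adj B S := by
  classical
  obtain ⟨P, hfirst, hlast, hdisj⟩ := hS
  have huniq : ∀ {v w : S} {x : V}, x ∈ (P v).verts → x ∈ (P w).verts → v = w := by
    intro v w x hv hw
    by_contra hne
    exact Set.disjoint_left.1 (hdisj v w hne) hv hw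
  have hstart : ∀ v : S, (v : V) ∈ (P v).verts := fun v => by
    have := List.head_mem (P v).ne
    rwa [show (P v).verts.head _ = v from hfirst v] at this
  let R : V → V → Prop := fun x y => ∃ v : S, ∃ i, ∃ h : i + 1 < (P v).verts.length,
    (P v).verts[i] = x ∧ (P v).verts[i + 1] = y
  have hRinj : ∀ {x x' y}, R x y → R x' y → x = x' := by
    rintro x x' y ⟨v, i, h, rfl, hy⟩ ⟨v', i', h', rfl, hy'⟩
    obtain rfl : v = v' := huniq (x := y) (by rw [← hy]; exact List.getElem_mem _)
      (by rw [← hy']; exact List.getElem_mem _)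
    have := (P v).nodup.getElem_inj_iff.1 (hy.trans hy'.symm)
    obtain rfl : i = i' := by omega
    rfl
  have hRadj : ∀ {x y}, R x y → Adj x y := by
    rintro x y ⟨v, i, h, rfl, rfl⟩
    exact List.isChain_iff_getElem.1 (P v).chain i h
  have hRS : ∀ {x y}, R x y → y ∉ S := by
    rintro x y ⟨v, i, h, rfl, hy⟩ hyS
    have h0 : (P ⟨y, hyS⟩).verts[0]'(List.length_pos_of_ne_nil (P _).ne) = y := by
      rw [List.getElem_zero]
      exact hfirst ⟨y, hyS⟩
    have hv : v = ⟨y, hyS⟩ := huniq (x := y) (by rw [← hy]; exact List.getElem_mem _)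
      (hstart ⟨y, hyS⟩)
    subst hv
    have := (P _).nodup.getElem_inj_iff.1 (hy.trans h0.symm)
    omega
  have hRex : ∀ {x}, x ∉ B → (∃ v : S, x ∈ (P v).verts) → ∃ y, R x y := by
    rintro x hx ⟨v, hv⟩
    obtain ⟨i, hi, rfl⟩ := List.getElem_of_mem hv
    by_cases h : i + 1 < (P v).verts.length
    · exact ⟨_, v, i, h, rfl, rfl⟩
    · refine absurd (hlast v) ?_
      have : (P v).last = (P v).verts[i] := by
        rw [DiPath.last, List.getLast_eq_getElem]
        congr 1
        omega
      rwa [this]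
  let m : V → V := fun x => if h : ∃ y, R x y then h.choose else x
  have hm1 : ∀ {x}, (∃ y, R x y) → R x (m x) := by
    intro x h
    have : m x = h.choose := dif_pos h
    rw [this]
    exact h.choose_spec
  have hm2 : ∀ {x}, ¬ (∃ y, R x y) → m x = x := fun h => dif_neg h
  have hRmem : ∀ {x y}, R x y → ∃ v : S, y ∈ (P v).verts := by
    rintro x y ⟨v, i, h, rfl, rfl⟩
    exact ⟨v, List.getElem_mem _⟩
  refine ⟨m, ⟨?_, ?_⟩, ?_, ?_⟩
  · intro x hx x' hx' hxx
    by_cases h : ∃ y, R x y <;> by_cases h' : ∃ y, R x' y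
    · exact hRinj (hm1 h) (hxx ▸ hm1 h')
    · exact absurd (hRex hx' (by rw [← hm2 h', ← hxx]; exact hRmem (hm1 h))) h'
    · exact absurd (hRex hx (by rw [← hm2 h, hxx]; exact hRmem (hm1 h'))) h
    · rw [← hm2 h, hxx, hm2 h']
  · intro x _
    by_cases h : ∃ y, R x y
    · exact Or.inr (hRadj (hm1 h))
    · exact Or.inl (hm2 h)
  · have := hSfin.to_subtype
    refine (Set.finite_iUnion fun v : S => (P v).verts.finite_toSet).subset ?_
    rintro x ⟨_, hx⟩
    have : ∃ y, R x y := by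
      by_contra h
      exact hx (hm2 h)
    obtain ⟨y, v, i, h, rfl, _⟩ := this
    exact Set.mem_iUnion.2 ⟨v, List.getElem_mem _⟩
  · intro x hx
    by_cases h : ∃ y, R x y
    · exact hRS (hm1 h)
    · rw [hm2 h]
      intro hxS
      exact h (hRex hx ⟨⟨x, hxS⟩, hstart _⟩)

lemma StepMap.iterate_inj {m : V → V} (hm : StepMap Adj B m) {v w : V}
    (hv : ∀ x, x ∉ B → m x ≠ v) (hw : ∀ x, x ∉ B → m x ≠ w) (i : ℕ) :
    ∀ j, (∀ k < i, m^[k] v ∉ B) → (∀ k < j, m^[k] w ∉ B) → m^[i] v = m^[j] w →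
      i = j ∧ v = w := by
  induction i with
  | zero =>
    rintro (_ | j) _ hj h
    · exact ⟨rfl, h⟩
    · rw [Function.iterate_succ_apply'] at h
      exact absurd h.symm (hv _ (hj j (by omega)))
  | succ i ih =>
    rintro (_ | j) hi hj h
    · rw [Function.iterate_succ_apply'] at h
      exact absurd h (hw _ (hi i (by omega)))
    · rw [Function.iterate_succ_apply', Function.iterate_succ_apply'] at h
      have := ih j (fun k hk => hi k (by omega)) (fun k hk => hj k (by omega))
        (hm.injOn (hi i (by omega)) (hj j (by omega)) h)
      exact ⟨by omega, this.2⟩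

lemma StepMap.iterate_ne {m : V → V} (hm : StepMap Adj B m) {v : V}
    (hv : ∀ x, x ∉ B → m x ≠ v) {k : ℕ} (hk : ∀ j ≤ k, m^[j] v ∉ B) :
    m (m^[k] v) ≠ m^[k] v := by
  intro h
  rw [← Function.iterate_succ_apply' m k v] at h
  have := (hm.iterate_inj hv hv (k + 1) k (fun j hj => hk j (by omega))
    (fun j hj => hk j (by omega)) h).1
  omega

lemma StepMap.iterate_adj {m : V → V} (hm : StepMap Adj B m) {v : V}
    (hv : ∀ x, x ∉ B → m x ≠ v) {k : ℕ} (hk : ∀ j ≤ k, m^[j] v ∉ B) :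
    Adj (m^[k] v) (m^[k + 1] v) := by
  rw [Function.iterate_succ_apply']
  exact (hm.step _ (hk k le_rfl)).resolve_left (hm.iterate_ne hv hk)

/-- The path following a step map up to the `n`-th iterate. -/
def StepMap.orbitPath {m : V → V} (hm : StepMap Adj B m) {v : V}
    (hv : ∀ x, x ∉ B → m x ≠ v) {n : ℕ} (hn : ∀ j < n, m^[j] v ∉ B) : DiPath Adj where
  verts := (List.range (n + 1)).map fun k => m^[k] v
  ne := by simp
  chain := by
    refine List.isChain_iff_getElem.2 fun i hi => ?_
    simp only [List.length_map, List.length_range] at hi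
    simp only [List.getElem_map, List.getElem_range]
    exact hm.iterate_adj hv fun j hj => hn j (by omega)
  nodup := by
    refine List.Nodup.map_on (fun i hi j hj h => ?_) List.nodup_range
    simp only [List.mem_range] at hi hj
    exact (hm.iterate_inj hv hv i j (fun k hk => hn k (by omega))
      (fun k hk => hn k (by omega)) h).1

/-- The ray following a step map along an orbit avoiding `B`. -/
def StepMap.orbitRay {m : V → V} (hm : StepMap Adj B m) {v : V}
    (hv : ∀ x, x ∉ B → m x ≠ v) (hn : ∀ j, m^[j] v ∉ B) : DiRay Adj where
  f := fun k => m^[k] v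
  inj i j h := (hm.iterate_inj hv hv i j (fun k _ => hn k) (fun k _ => hn k) h).1
  adj _ := hm.iterate_adj hv fun j _ => hn j

/-- Following a step map that avoids `I` from the vertices of `I` yields disjoint paths to `B`
and rays. -/
lemma StepMap.exists_linkage {m : V → V} (hm : StepMap Adj B m) {I : Set V}
    (hI : ∀ x, x ∉ B → m x ∉ I) :
    ∃ Q : I → PR Adj, (∀ v : I, (Q v).first = v) ∧
      (∀ v, (∃ P, Q v = PR.path P ∧ P.last ∈ B) ∨
        ∃ R, Q v = PR.ray R ∧ ∀ n, R.f n ∉ B ∧ m (R.f n) ≠ R.f n) ∧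
      ∀ v w : I, v ≠ w → Disjoint (Q v).vertexSet (Q w).vertexSet := by
  classical
  have hv : ∀ v : I, ∀ x, x ∉ B → m x ≠ v := by
    rintro ⟨v, hv⟩ x hx rfl
    exact hI x hx hv
  have key : ∀ v : I, ∃ Q : PR Adj, Q.first = v ∧
      ((∃ P, Q = PR.path P ∧ P.last ∈ B) ∨
        ∃ R, Q = PR.ray R ∧ ∀ n, R.f n ∉ B ∧ m (R.f n) ≠ R.f n) ∧
      ∀ x ∈ Q.vertexSet, ∃ n, (∀ k < n, m^[k] (v : V) ∉ B) ∧ x = m^[n] (v : V) := by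
    intro v
    by_cases h : ∃ n, m^[n] (v : V) ∈ B
    · have hn : ∀ k < Nat.find h, m^[k] (v : V) ∉ B := fun k hk => Nat.find_min h hk
      refine ⟨PR.path (hm.orbitPath (hv v) hn), ?_, Or.inl ⟨_, rfl, ?_⟩, ?_⟩
      · simp [PR.first, DiPath.first, StepMap.orbitPath, List.range_succ_eq_map]
      · have : (hm.orbitPath (hv v) hn).last = m^[Nat.find h] (v : V) := by
          simp only [DiPath.last, StepMap.orbitPath, List.getLast_eq_getElem, List.getElem_map,
            List.getElem_range, List.length_map, List.length_range, Nat.add_sub_cancel]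
        rw [this]
        exact Nat.find_spec h
      · intro x hx
        obtain ⟨k, hk, rfl⟩ := List.mem_map.1 hx
        rw [List.mem_range] at hk
        exact ⟨k, fun j hj => hn j (by omega), rfl⟩
    · have hn : ∀ k, m^[k] (v : V) ∉ B := fun k hk => h ⟨k, hk⟩
      refine ⟨PR.ray (hm.orbitRay (hv v) hn), rfl, Or.inr ⟨_, rfl, fun n => ⟨hn n, ?_⟩⟩, ?_⟩
      · exact hm.iterate_ne (hv v) fun j _ => hn j
      · rintro x ⟨k, rfl⟩
        exact ⟨k, fun j _ => hn j, rfl⟩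
  choose Q h1 h2 h3 using key
  refine ⟨Q, h1, h2, fun v w hvw => Set.disjoint_left.2 fun x hx hx' => hvw ?_⟩
  obtain ⟨i, hi, rfl⟩ := h3 v x hx
  obtain ⟨j, hj, hij⟩ := h3 w _ hx'
  exact Subtype.ext (hm.iterate_inj (hv v) (hv w) i j hi hj hij).2

lemma Avoidable.mem_LGB {S : Set V} (hS : Avoidable Adj B S) : S ∈ LGB Adj B := by
  obtain ⟨m, hm, hfin, hmS⟩ := hS
  obtain ⟨Q, h1, h2, h3⟩ := hm.exists_linkage hmS
  have hpath : ∀ v, ∃ P, Q v = PR.path P ∧ P.last ∈ B := by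
    intro v
    refine (h2 v).resolve_right ?_
    rintro ⟨R, _, hR⟩
    exact Set.infinite_range_of_injective R.inj (hfin.subset (by rintro _ ⟨n, rfl⟩; exact hR n))
  choose P hP hPB using hpath
  refine ⟨P, fun v => ?_, hPB, fun v w hvw => ?_⟩
  · rw [← h1 v, hP v]
    rfl
  · have := h3 v w hvw
    rwa [hP v, hP w] at this

end

section
open Set
variable {V : Type*} {Adj : V → V → Prop} {B : Set V}

open Classical in
/-- The finitary matroid whose finite independent sets are those linked to `B`. -/
noncomputable def linkMatroid (Adj : V → V → Prop) (B : Set V) : Matroid V :=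
  (IndepMatroid.ofFinset univ (fun S => Avoidable Adj B S)
    (by simpa using avoidable_empty)
    (fun _ _ hJ hIJ => hJ.mono (by exact_mod_cast hIJ))
    (fun I J hI hJ hIJ => by
      by_contra! h
      obtain ⟨X, hX, hsep⟩ := hI.exists_separates (Z := J) fun z hz hzI => by
        have := h z (by simpa using hz) (by simpa using hzI)
        rwa [Finset.coe_insert] at this
      have := hsep.encard_le hJ subset_rfl
      rw [hX, encard_coe_eq_coe_finsetCard, encard_coe_eq_coe_finsetCard, Nat.cast_le] at this
      omega)
    (fun _ _ => subset_univ _)).matroid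

lemma linkMatroid_indep_iff {J : Set V} :
    (linkMatroid Adj B).Indep J ↔ ∀ S : Finset V, ↑S ⊆ J → Avoidable Adj B S := by
  classical
  rw [linkMatroid, IndepMatroid.matroid_Indep, IndepMatroid.ofFinset_indep']

instance linkMatroid_finitary : (linkMatroid Adj B).Finitary := by
  refine ⟨fun I hI => linkMatroid_indep_iff.2 fun S hS => ?_⟩
  exact linkMatroid_indep_iff.1 (hI S hS S.finite_toSet) S subset_rfl

lemma linkMatroid_indep_iff_of_finite {S : Set V} (hS : S.Finite) :
    (linkMatroid Adj B).Indep S ↔ Avoidable Adj B S := by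
  lift S to Finset V using hS
  rw [linkMatroid_indep_iff]
  exact ⟨fun h => h S subset_rfl, fun h T hT => h.mono hT⟩

lemma mem_closure_linkMatroid {S : Set V} (hS : S.Finite) (hind : (linkMatroid Adj B).Indep S)
    {z : V} : z ∈ (linkMatroid Adj B).closure S ↔ (Avoidable Adj B (insert z S) → z ∈ S) := by
  rw [hind.mem_closure_iff', linkMatroid_indep_iff_of_finite (hS.insert z)]
  exact and_iff_right (mem_univ z)

/-- The vertices of `F` outside `B` all of whose out-neighbours lie in `F`. -/
def inner (Adj : V → V → Prop) (B F : Set V) : Set V :=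
  {x | x ∉ B ∧ x ∈ F ∧ ∀ y, Adj x y → y ∈ F}

lemma inner_mono {F F' : Set V} (h : F ⊆ F') : inner Adj B F ⊆ inner Adj B F' :=
  fun _ hx => ⟨hx.1, h hx.2.1, fun y hy => h (hx.2.2 y hy)⟩

lemma inner_inter (F F' : Set V) :
    inner Adj B (F ∩ F') = inner Adj B F ∩ inner Adj B F' := by
  ext x
  constructor
  · exact fun h => ⟨inner_mono inter_subset_left h, inner_mono inter_subset_right h⟩
  · exact fun h => ⟨h.1.1, ⟨h.1.2.1, h.2.2.1⟩, fun y hy => ⟨h.1.2.2 y hy, h.2.2.2 y hy⟩⟩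

lemma encard_closure_diff_inner_le {S : Set V} (hS : S.Finite)
    (hind : (linkMatroid Adj B).Indep S) :
    ((linkMatroid Adj B).closure S \ inner Adj B ((linkMatroid Adj B).closure S)).encard ≤
      S.encard := by
  set F := (linkMatroid Adj B).closure S with hF
  obtain ⟨X, hX, L, hLB, hZ, hL⟩ :=
    ((linkMatroid_indep_iff_of_finite hS).1 hind).exists_separates (Z := F)
      fun z hz hzS h => hzS ((mem_closure_linkMatroid hS hind).1 hz h)
  have hFeq : X ∪ L ⊆ F := by
    intro z hz
    rw [hF, mem_closure_linkMatroid hS hind]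
    intro h
    by_contra hzS
    have hsep : Separates Adj B X (X ∪ L) := ⟨L, hLB, subset_rfl, hL⟩
    have hsub : insert z S ⊆ X ∪ L := insert_subset hz
      (((linkMatroid Adj B).subset_closure S (subset_univ _)).trans hZ)
    have := hsep.encard_le h hsub
    rw [hX, encard_insert_of_notMem hzS] at this
    exact (ENat.lt_add_one_iff hS.encard_lt_top.ne).2 le_rfl |>.not_ge this
  rw [← hX]
  refine encard_le_encard fun x hx => (hZ hx.1).resolve_right fun hxL => hx.2 ?_
  exact ⟨hLB x hxL, hx.1, fun y hy => hFeq (hL x hxL y hy)⟩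

lemma exists_stepMap_image_inner {S : Set V} (hS : S.Finite)
    (hind : (linkMatroid Adj B).Indep S) :
    ∃ m, StepMap Adj B m ∧ {x | x ∉ B ∧ m x ≠ x}.Finite ∧ ∀ S' ⊆ S,
      m '' inner Adj B ((linkMatroid Adj B).closure S') =
        (linkMatroid Adj B).closure S' \ S' := by
  obtain ⟨m, hm, hfin, hmS⟩ := (linkMatroid_indep_iff_of_finite hS).1 hind
  refine ⟨m, hm, hfin, fun S' hS' => ?_⟩
  set F := (linkMatroid Adj B).closure S' with hF
  have hmaps : MapsTo m (inner Adj B F) F := by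
    intro x hx
    rcases hm.step x hx.1 with h | h
    · rw [h]
      exact hx.2.1
    · exact hx.2.2 _ h
  have hcard := encard_diff_image_of_finite_support (fun x hx => hx.2.1) hmaps
    (hm.injOn.mono fun x hx => hx.1) (hfin.subset fun x hx => ⟨hx.1.1, hx.2⟩)
  have hsub : S' ⊆ F \ m '' inner Adj B F := by
    intro x hx
    refine ⟨(linkMatroid Adj B).subset_closure S' (subset_univ _) hx, ?_⟩
    rintro ⟨y, hy, rfl⟩
    exact hmS y hy.1 (hS' hx)
  have heq := (hS.subset hS').eq_of_subset_of_encard_le hsub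
    (hcard.trans_le (encard_closure_diff_inner_le (hS.subset hS') (hind.subset hS')))
  conv_rhs => rw [heq]
  rw [sdiff_sdiff_cancel_left hmaps.image_subset]

/-- The vertices outside `B` which, together with their out-neighbours, are spanned by a finite
subset of `I`. -/
def tameSet (Adj : V → V → Prop) (B I : Set V) : Set V :=
  {x | ∃ S ⊆ I, S.Finite ∧ x ∈ inner Adj B ((linkMatroid Adj B).closure S)}

lemma exists_least_support {I : Set V} (hI : (linkMatroid Adj B).Indep I) {x : V}
    (hx : x ∈ tameSet Adj B I) :
    ∃ S ⊆ I, S.Finite ∧ x ∈ inner Adj B ((linkMatroid Adj B).closure S) ∧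
      ∀ S' ⊆ I, S'.Finite → x ∈ inner Adj B ((linkMatroid Adj B).closure S') → S ⊆ S' := by
  obtain ⟨S, ⟨hSI, hS, hxS⟩, hmin⟩ := WellFounded.has_min (measure (Set.ncard (α := V))).wf
    {S | S ⊆ I ∧ S.Finite ∧ x ∈ inner Adj B ((linkMatroid Adj B).closure S)} hx
  refine ⟨S, hSI, hS, hxS, fun S' hSI' _ hxS' => ?_⟩
  have hmem : x ∈ inner Adj B ((linkMatroid Adj B).closure (S ∩ S')) := by
    rw [(hI.subset (union_subset hSI hSI')).closure_inter_eq_inter_closure, inner_inter]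
    exact ⟨hxS, hxS'⟩
  have h := hmin (S ∩ S') ⟨inter_subset_left.trans hSI, hS.subset inter_subset_left, hmem⟩
  exact inter_eq_left.1 (eq_of_subset_of_ncard_le inter_subset_left (not_lt.1 h) hS)

/-- An independent set is avoided by a step map on the tame vertices which moves only finitely
many vertices inside the span of each finite subset. -/
lemma exists_stepMap_tameSet {I : Set V} (hI : (linkMatroid Adj B).Indep I) :
    ∃ m, StepMap Adj (tameSet Adj B I)ᶜ m ∧ (∀ x ∈ tameSet Adj B I, m x ∉ I) ∧
      ∀ S ⊆ I, S.Finite →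
        {x | x ∈ inner Adj B ((linkMatroid Adj B).closure S) ∧ m x ≠ x}.Finite := by
  classical
  have hloc : ∀ S : {S : Set V // S ⊆ I ∧ S.Finite}, ∃ m, StepMap Adj B m ∧
      {x | x ∉ B ∧ m x ≠ x}.Finite ∧ ∀ S' ⊆ S.1,
        m '' inner Adj B ((linkMatroid Adj B).closure S') =
          (linkMatroid Adj B).closure S' \ S' :=
    fun S => exists_stepMap_image_inner S.2.2 (hI.subset S.2.1)
  choose loc hloc1 hloc2 hloc3 using hloc
  have hst : ∀ x, ∃ S : {S : Set V // S ⊆ I ∧ S.Finite}, x ∈ tameSet Adj B I →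
      x ∈ inner Adj B ((linkMatroid Adj B).closure S.1) ∧
      ∀ S' ⊆ I, S'.Finite → x ∈ inner Adj B ((linkMatroid Adj B).closure S') → S.1 ⊆ S' := by
    intro x
    by_cases hx : x ∈ tameSet Adj B I
    · obtain ⟨S, h1, h2, h3⟩ := exists_least_support hI hx
      exact ⟨⟨S, h1, h2⟩, fun _ => h3⟩
    · exact ⟨⟨∅, empty_subset _, finite_empty⟩, fun h => absurd h hx⟩
  choose st hst using hst
  have hrange : ∀ x ∈ tameSet Adj B I,
      loc (st x) x ∈ (linkMatroid Adj B).closure (st x).1 \ (st x).1 := by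
    intro x hx
    rw [← hloc3 (st x) _ subset_rfl]
    exact mem_image_of_mem _ (hst x hx).1
  have havoid : ∀ x ∈ tameSet Adj B I, loc (st x) x ∉ I := by
    intro x hx h
    refine (hrange x hx).2 ?_
    rw [← hI.closure_inter_eq_self_of_subset (st x).2.1]
    exact ⟨(hrange x hx).1, h⟩
  have hsupp : ∀ x ∈ tameSet Adj B I, ∀ x' ∈ tameSet Adj B I,
      loc (st x) x = loc (st x') x' → (st x).1 ⊆ (st x').1 := by
    intro x hx x' hx' hxx
    have hmem : loc (st x) x ∈
        (linkMatroid Adj B).closure ((st x).1 ∩ (st x').1) \ ((st x).1 ∩ (st x').1) := by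
      rw [(hI.subset (union_subset (st x).2.1 (st x').2.1)).closure_inter_eq_inter_closure]
      refine ⟨⟨(hrange x hx).1, ?_⟩, fun h => (hrange x hx).2 h.1⟩
      rw [hxx]
      exact (hrange x' hx').1
    rw [← hloc3 (st x) _ inter_subset_left] at hmem
    obtain ⟨z, hz, hzx⟩ := hmem
    obtain rfl : z = x := (hloc1 (st x)).injOn hz.1 (hst x hx).1.1 hzx
    exact ((hst z hx).2 _ (inter_subset_left.trans (st z).2.1)
      ((st z).2.2.subset inter_subset_left) hz).trans inter_subset_right
  refine ⟨fun x => loc (st x) x, ⟨?_, ?_⟩, havoid, ?_⟩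
  · intro x hx x' hx' hxx
    rw [compl_compl] at hx hx'
    have heq : st x = st x' := Subtype.ext
      ((hsupp x hx x' hx' hxx).antisymm (hsupp x' hx' x hx hxx.symm))
    have hxx' : loc (st x) x = loc (st x) x' := by
      nth_rw 2 [heq]
      exact hxx
    exact (hloc1 (st x)).injOn (hst x hx).1.1 (hst x' hx').1.1 hxx'
  · intro x hx
    rw [mem_compl_iff, not_not] at hx
    exact (hloc1 (st x)).step x (hst x hx).1.1
  · intro S hSI hS
    have hfin : (⋃ T ∈ {T : {S : Set V // S ⊆ I ∧ S.Finite} | T.1 ⊆ S},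
        {x | x ∉ B ∧ loc T x ≠ x}).Finite := by
      refine Set.Finite.biUnion ?_ fun T _ => hloc2 T
      exact (hS.finite_subsets).preimage Subtype.val_injective.injOn
    refine hfin.subset ?_
    rintro x ⟨hx, hmx⟩
    have hxt : x ∈ tameSet Adj B I := ⟨S, hSI, hS, hx⟩
    exact mem_biUnion ((hst x hxt).2 S hSI hS hx) ⟨hx.1, hmx⟩

end

section
open Set
variable {V : Type*} {Adj : V → V → Prop} {B : Set V}

/-- `B` can be reached from `u` by a path avoiding `X`. -/
def Reach (Adj : V → V → Prop) (B X : Set V) (u : V) : Prop :=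
  ∃ P : DiPath Adj, P.first = u ∧ P.last ∈ B ∧ ∀ x ∈ P.vertexSet, x ∉ X

lemma DiPath.finite_vertexSet (P : DiPath Adj) : P.vertexSet.Finite := P.verts.finite_toSet

lemma DiPath.first_mem (P : DiPath Adj) : P.first ∈ P.vertexSet := List.head_mem P.ne

lemma DiPath.last_mem (P : DiPath Adj) : P.last ∈ P.vertexSet := List.getLast_mem P.ne

lemma reach_of_mem {X : Set V} {u : V} (hu : u ∈ B) (huX : u ∉ X) : Reach Adj B X u :=
  ⟨⟨[u], by simp, List.isChain_singleton u, List.nodup_singleton u⟩, rfl, hu,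
    fun x hx => by rwa [List.mem_singleton.1 hx]⟩

lemma Reach.cons {X : Set V} {u w : V} (hw : Reach Adj B X w) (huw : Adj u w) (huX : u ∉ X) :
    Reach Adj B X u := by
  obtain ⟨P, hP, hPB, hPX⟩ := hw
  by_cases hu : u ∈ P.verts
  · obtain ⟨a, b, hab⟩ := List.append_of_mem hu
    have hsuf : u :: b <:+ P.verts := ⟨a, hab.symm⟩
    refine ⟨⟨u :: b, by simp, P.chain.suffix hsuf, P.nodup.sublist hsuf.sublist⟩, rfl, ?_,
      fun x hx => hPX x (hsuf.subset hx)⟩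
    have : P.last = (u :: b).getLast (by simp) := by
      simp only [DiPath.last, hab]
      rw [List.getLast_append_of_ne_nil]
    rwa [this] at hPB
  · refine ⟨⟨u :: P.verts, by simp, ?_, List.nodup_cons.2 ⟨hu, P.nodup⟩⟩, rfl, ?_, ?_⟩
    · refine List.isChain_cons.2 ⟨fun y hy => ?_, P.chain⟩
      rw [List.head?_eq_some_head P.ne] at hy
      rw [← Option.mem_some.1 hy]
      exact hP.symm.subst (motive := Adj u) huw
    · have : (u :: P.verts).getLast (by simp) = P.last := List.getLast_cons P.ne
      simpa [DiPath.last, this] using hPB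
    · intro x hx
      rcases List.mem_cons.1 hx with rfl | hx
      · exact huX
      · exact hPX x hx

lemma separates_of_not_reach {X Z : Set V} (h : ∀ z ∈ Z, z ∈ X ∨ ¬ Reach Adj B X z) :
    Separates Adj B X Z := by
  have hX : ∀ y, ¬ Reach Adj B X y → y ∈ X ∪ {u | u ∉ X ∧ ¬ Reach Adj B X u} := fun y hy => by
    by_cases hyX : y ∈ X
    · exact Or.inl hyX
    · exact Or.inr ⟨hyX, hy⟩
  refine ⟨{u | u ∉ X ∧ ¬ Reach Adj B X u}, fun x hx hxB => hx.2 (reach_of_mem hxB hx.1),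
    fun z hz => (h z hz).elim Or.inl (hX z), fun x hx y hxy => ?_⟩
  exact hX y fun hy => hx.2 (hy.cons hxy hx.1)

lemma Separates.subset_closure {X Z I : Set V} (hsep : Separates Adj B X Z) (hX : X.Finite)
    (hI : (linkMatroid Adj B).IsBase I) :
    ∃ S ⊆ I, S.Finite ∧ (linkMatroid Adj B).Indep S ∧ Z ⊆ (linkMatroid Adj B).closure S := by
  obtain ⟨T, hT⟩ := (linkMatroid Adj B).exists_isBasis Z (subset_univ _)
  have hTfin : T.Finite := by
    by_contra hinf
    obtain ⟨U, hUT, hU⟩ := Set.Infinite.exists_subset_card_eq hinf (hX.toFinset.card + 1)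
    have h := hsep.encard_le (linkMatroid_indep_iff.1 hT.indep U hUT) (hUT.trans hT.subset)
    rw [hX.encard_eq_coe_toFinset_card, encard_coe_eq_coe_finsetCard, Nat.cast_le] at h
    omega
  obtain ⟨S, hSI, hS, hind, hcl⟩ := Matroid.exists_subset_finite_closure_of_subset_closure
    (M := linkMatroid Adj B) (Y := I) hTfin
    (by rw [hI.closure_eq]; exact subset_univ _)
  exact ⟨S, hSI, hS, hind, hT.subset_closure.trans
    (Matroid.closure_subset_closure_of_subset_closure hcl)⟩

/-- Outside the tame set of a base, every vertex lies in `B` or dominates `B`. -/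
lemma vDomSet_of_notMem_tameSet {I : Set V} (hI : (linkMatroid Adj B).IsBase I) {x : V}
    (hx : x ∉ tameSet Adj B I) (hxB : x ∉ B) : VDomSet Adj B x := by
  have hreach : ∀ X : Set V, X.Finite → x ∉ X → Reach Adj B X x := by
    intro X hX hxX
    by_contra h
    have hsep : Separates Adj B X (insert x {y | Adj x y}) := by
      refine separates_of_not_reach fun z hz => ?_
      rcases hz with rfl | hz
      · exact Or.inr h
      · exact Or.inr fun hr => h (hr.cons hz hxX)
    obtain ⟨S, hSI, hS, -, hcl⟩ := hsep.subset_closure hX hI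
    exact hx ⟨S, hSI, hS, hxB, hcl (mem_insert _ _), fun y hy => hcl (Or.inr hy)⟩
  let r : DiPath Adj → DiPath Adj → Prop := fun P Q =>
    ∀ y ∈ P.vertexSet, y ∈ Q.vertexSet → y = x
  have : Std.Symm r := ⟨fun P Q h y hy hy' => h y hy' hy⟩
  obtain ⟨f, hf, hr⟩ := exists_seq_of_forall_finset_exists'
    (fun P : DiPath Adj => P.first = x ∧ P.last ∈ B) r fun s _ => by
      obtain ⟨P, h1, h2, h3⟩ := hreach ((⋃ P ∈ s, P.vertexSet) \ {x})
        ((s.finite_toSet.biUnion fun P _ => P.finite_vertexSet).subset sdiff_subset)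
        (fun h => h.2 rfl)
      refine ⟨P, ⟨h1, h2⟩, fun Q hQ y hyQ hyP => by_contra fun hyx => ?_⟩
      exact h3 y hyP ⟨mem_biUnion (s := (s : Set (DiPath Adj))) hQ hyQ, hyx⟩
  refine ⟨f, fun i j hij => by_contra fun hne => ?_, fun n => (hf n).1, fun n => (hf n).2,
    fun i j hij => hr hij⟩
  have := hr hne (f i).last (f i).last_mem (hij ▸ (f i).last_mem)
  exact hxB (this ▸ (hf i).2)

lemma rDomSet_of_reach {R : DiRay Adj}
    (h : ∀ X : Set V, X.Finite → ∃ n, Reach Adj B X (R.f n)) : RDomSet Adj B R := by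
  let r : DiPath Adj → DiPath Adj → Prop := fun P Q => Disjoint P.vertexSet Q.vertexSet
  have : Std.Symm r := ⟨fun P Q h => h.symm⟩
  obtain ⟨f, hf, hr⟩ := exists_seq_of_forall_finset_exists'
    (fun P : DiPath Adj => P.first ∈ R.vertexSet ∧ P.last ∈ B) r fun s _ => by
      obtain ⟨n, P, h1, h2, h3⟩ := h (⋃ P ∈ s, P.vertexSet)
        (s.finite_toSet.biUnion fun P _ => P.finite_vertexSet)
      refine ⟨P, ⟨⟨n, h1.symm⟩, h2⟩, fun Q hQ => Set.disjoint_left.2 fun y hyQ hyP => ?_⟩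
      exact h3 y hyP (mem_biUnion (s := (s : Set (DiPath Adj))) hQ hyQ)
  refine ⟨f, fun i j hij => by_contra fun hne => ?_, fun n => (hf n).1, fun n => (hf n).2,
    fun i j hij => hr hij⟩
  exact Set.disjoint_left.1 (hr hne) (f i).last_mem (hij ▸ (f i).last_mem)

lemma vDomLinkage_of_indep {I : Set V} (hI : (linkMatroid Adj B).Indep I) :
    VDomLinkage Adj I B := by
  obtain ⟨J, hJ, hIJ⟩ := hI.exists_isBase_superset
  obtain ⟨m, hm, hmJ, hfin⟩ := exists_stepMap_tameSet hJ.indep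
  obtain ⟨Q, h1, h2, h3⟩ := hm.exists_linkage (I := J) fun x hx => hmJ x (not_not.1 hx)
  refine ⟨fun v => Q ⟨v, hIJ v.2⟩, fun v => h1 _, fun v => ?_, fun v w hvw => h3 _ _ ?_⟩
  · rcases h2 ⟨v, hIJ v.2⟩ with ⟨P, hP, hlast⟩ | ⟨R, hR, hn⟩
    · simp only [hP, PR.GoodV]
      by_cases hB : P.last ∈ B
      · exact Or.inl hB
      · exact Or.inr (vDomSet_of_notMem_tameSet hJ hlast hB)
    · simp only [hR, PR.GoodV]
      refine rDomSet_of_reach fun X hX => ?_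
      by_contra! hX'
      have hsep : Separates Adj B X (range R.f) :=
        separates_of_not_reach (by rintro _ ⟨n, rfl⟩; exact Or.inr (hX' n))
      obtain ⟨S, hSJ, hS, hind, hcl⟩ := hsep.subset_closure hX hJ
      have h4 := finite_of_encard_le_coe (k := S.ncard)
        ((encard_closure_diff_inner_le hS hind).trans hS.cast_ncard_eq.ge)
      refine infinite_range_of_injective R.inj ((h4.union (hfin S hSJ hS)).subset ?_)
      rintro _ ⟨n, rfl⟩
      by_cases hi : R.f n ∈ inner Adj B ((linkMatroid Adj B).closure S)
      · exact Or.inr ⟨hi, (hn n).2⟩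
      · exact Or.inl ⟨hcl ⟨n, rfl⟩, hi⟩
  · exact fun h => hvw (Subtype.ext (congrArg (fun x : J => (x : V)) h))

/-- A path avoiding `X` and starting in a region left only through `X` stays in it. -/
lemma DiPath.subset_of_closed {X L : Set V} (hL : ∀ x ∈ L, ∀ y, Adj x y → y ∈ X ∪ L)
    (P : DiPath Adj) (hP : P.first ∈ L) (hX : ∀ x ∈ P.vertexSet, x ∉ X) : P.vertexSet ⊆ L := by
  have key : ∀ i (hi : i < P.verts.length), P.verts[i] ∈ L := by
    intro i
    induction i with
    | zero =>
      intro hi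
      rwa [DiPath.first, List.head_eq_getElem] at hP
    | succ i ih =>
      intro hi
      exact (hL _ (ih (by omega)) _ (List.isChain_iff_getElem.1 P.chain i hi)).resolve_left
        (hX _ (List.getElem_mem hi))
  intro x hx
  obtain ⟨i, hi, rfl⟩ := List.getElem_of_mem hx
  exact key i hi

lemma DiRay.subset_of_closed {X L : Set V} (hL : ∀ x ∈ L, ∀ y, Adj x y → y ∈ X ∪ L)
    (R : DiRay Adj) (hR : R.first ∈ L) (hX : ∀ x ∈ R.vertexSet, x ∉ X) : R.vertexSet ⊆ L := by
  rintro _ ⟨n, rfl⟩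
  induction n with
  | zero => exact hR
  | succ n ih => exact (hL _ ih _ (R.adj n)).resolve_left (hX _ ⟨n + 1, rfl⟩)

/-- A sequence of sets pairwise disjoint on a finite set `X` has a member missing `X`. -/
lemma exists_disjoint_of_finite {X : Set V} (hX : X.Finite) {A : ℕ → Set V}
    (hA : ∀ i j, i ≠ j → ∀ x ∈ A i, x ∈ A j → x ∉ X) : ∃ n, ∀ x ∈ A n, x ∉ X := by
  by_contra! h
  choose g hg hgX using h
  have hinj : Function.Injective g := fun i j hij => by_contra fun hne =>
    hA i j hne (g i) (hg i) (hij ▸ hg j) (hgX i)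
  exact infinite_range_of_injective hinj (hX.subset (range_subset_iff.2 hgX))

lemma PR.GoodV.not_subset {X L : Set V} (hX : X.Finite) (hLB : ∀ x ∈ L, x ∉ B)
    (hL : ∀ x ∈ L, ∀ y, Adj x y → y ∈ X ∪ L) {Q : PR Adj} (hQ : Q.GoodV B) (hfirst : Q.first ∈ L) :
    ∃ x ∈ Q.vertexSet, x ∈ X := by
  by_contra! hQX
  have hpath : ∀ P : DiPath Adj, P.first ∈ L → P.last ∈ B → ¬ ∀ x ∈ P.vertexSet, x ∉ X :=
    fun P h1 h2 h3 => hLB _ (P.subset_of_closed hL h1 h3 P.last_mem) h2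
  cases Q with
  | path P =>
    rcases hQ with hB | ⟨W, -, h1, h2, h3⟩
    · exact hpath P hfirst hB hQX
    · obtain ⟨n, hn⟩ := exists_disjoint_of_finite hX (A := fun n => (W n).vertexSet)
        fun i j hij x hx hx' => h3 i j hij x hx hx' ▸ hQX _ P.last_mem
      exact hpath (W n) (h1 n ▸ P.subset_of_closed hL hfirst hQX P.last_mem) (h2 n) hn
  | ray R =>
    obtain ⟨W, -, h1, h2, h3⟩ := hQ
    obtain ⟨n, hn⟩ := exists_disjoint_of_finite hX (A := fun n => (W n).vertexSet)
      fun i j hij x hx hx' => (Set.disjoint_left.1 (h3 i j hij) hx hx').elim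
    exact hpath (W n) (R.subset_of_closed hL hfirst hQX (h1 n)) (h2 n) hn

lemma VDomLinkage.indep {I : Set V} (hI : VDomLinkage Adj I B) : (linkMatroid Adj B).Indep I := by
  obtain ⟨Q, h1, h2, h3⟩ := hI
  refine linkMatroid_indep_iff.2 fun S hSI => ?_
  by_contra hS
  obtain ⟨T, hT⟩ := (linkMatroid Adj B).exists_isBasis (S : Set V) (subset_univ _)
  have hTfin : T.Finite := S.finite_toSet.subset hT.subset
  obtain ⟨X, hXT, L, hLB, hSX, hL⟩ := Avoidable.exists_separates (Z := (S : Set V))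
    ((linkMatroid_indep_iff_of_finite hTfin).1 hT.indep) fun z hz hzT hav =>
      hzT ((mem_closure_linkMatroid hTfin hT.indep).1 (hT.subset_closure hz) hav)
  have hlt : X.encard < (S : Set V).encard := by
    rw [hXT]
    refine hTfin.encard_lt_encard (hT.subset.ssubset_of_ne ?_)
    rintro rfl
    exact hS ((linkMatroid_indep_iff_of_finite hTfin).1 hT.indep)
  have hX : X.Finite := finite_of_encard_le_coe (hXT.trans hTfin.cast_ncard_eq.symm).le
  have hmeet : ∀ s : S, ∃ x ∈ (Q ⟨s, hSI s.2⟩).vertexSet, x ∈ X := by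
    intro s
    rcases hSX s.2 with hs | hs
    · refine ⟨s, ?_, hs⟩
      have := h1 ⟨s, hSI s.2⟩
      cases hq : Q ⟨s, hSI s.2⟩ with
      | path P => rw [hq] at this; exact this ▸ P.first_mem
      | ray R => rw [hq] at this; exact this ▸ ⟨0, rfl⟩
    · exact (h2 _).not_subset hX hLB hL (by rw [h1]; exact hs)
  choose g hg hgX using hmeet
  have hinj : Function.Injective fun s : S => (⟨g s, hgX s⟩ : X) := by
    intro s t hst
    have hst : g s = g t := congrArg Subtype.val hst
    by_contra hne
    refine Set.disjoint_left.1 (h3 ⟨s, hSI s.2⟩ ⟨t, hSI t.2⟩ fun h => hne ?_) (hg s) (hst ▸ hg t)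
    exact Subtype.ext (congrArg (fun x : I => (x : V)) h)
  exact hlt.not_ge (Function.Embedding.encard_le (s := (S : Set V)) ⟨_, hinj⟩)

lemma vDomLinkage_iff_indep {I : Set V} : VDomLinkage Adj I B ↔ (linkMatroid Adj B).Indep I :=
  ⟨VDomLinkage.indep, vDomLinkage_of_indep⟩

end

theorem stmt17 {V : Type*} (Adj : V → V → Prop) (B : Set V) :
    (∀ I : Set V, VDomLinkage Adj I B ↔
      ∀ S : Finset V, ↑S ⊆ I → (↑S : Set V) ∈ LGB Adj B) ∧
    ∃ M : Matroid V, M.E = Set.univ ∧ M.Finitary ∧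
      ∀ J : Set V, M.Indep J ↔ VDomLinkage Adj J B := by
  refine ⟨fun I => ?_, linkMatroid Adj B, rfl, inferInstance,
    fun J => vDomLinkage_iff_indep.symm⟩
  rw [vDomLinkage_iff_indep, linkMatroid_indep_iff]
  exact forall₂_congr fun S _ =>
    ⟨Avoidable.mem_LGB, avoidable_of_mem_LGB S.finite_toSet⟩
end
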